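/- arXiv:math/9307215 — 11 statements merged into one kernel-verified Lean document; each statement's English description precedes it below -/
import Mathlib

section
/- Let (P_n)_{n≥-1} be a sequence of p×p real matrix polynomials with P_{-1} = 0 and P_0 = I, satisfying the three-term recurrence x·P_n(x) = D_{n+1}·P_{n+1}(x) + E_n·P_n(x) + D_n·P_{n-1}(x) for all n ≥ 0 and all real x, where each D_n is a symmetric invertible p×p matrix and each E_n is a symmetric p×p matrix. Then for all real x and all n ≥ 0: Σ_{i=0}^{n} P_i(x)^T · P_i(x) = (d/dx P_{n+1}(x)^T) · D_{n+1} · P_n(x) − (d/dx P_n(x)^T) · D_{n+1} · P_{n+1}(x), where d/dx denotes the entrywise derivative. -/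
open Polynomial Matrix

/-- Evaluation of a `p × p` matrix polynomial at a real number `x`
(entrywise evaluation, i.e. evaluation at the scalar matrix `x • 1`). -/
noncomputable def mev {p : ℕ} (P : Polynomial (Matrix (Fin p) (Fin p) ℝ)) (x : ℝ) :
    Matrix (Fin p) (Fin p) ℝ :=
  P.eval (x • (1 : Matrix (Fin p) (Fin p) ℝ))

/-- A matrix polynomial vanishing at every real number is zero. -/
theorem eq_zero_of_mev_eq_zero {p : ℕ} {Q : Polynomial (Matrix (Fin p) (Fin p) ℝ)}
    (h : ∀ x, mev Q x = 0) : Q = 0 := by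
  obtain ⟨M, rfl⟩ := matPolyEquiv.surjective Q
  suffices hM : M = 0 by rw [hM, map_zero]
  ext1 i j
  refine Polynomial.funext fun x => ?_
  rw [← matPolyEquiv_eval, Matrix.scalar_apply, ← Matrix.smul_one_eq_diagonal]
  simpa [mev] using congrFun (congrFun (h x) i) j

/-- Differentiating the three-term recurrence. -/
theorem mev_derivative_of_recurrence {p : ℕ} {F G H : Polynomial (Matrix (Fin p) (Fin p) ℝ)}
    {A B C : Matrix (Fin p) (Fin p) ℝ}
    (h : ∀ x : ℝ, x • mev F x = A * mev G x + B * mev F x + C * mev H x) (x : ℝ) :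
    mev F x + x • mev (derivative F) x =
      A * mev (derivative G) x + B * mev (derivative F) x + C * mev (derivative H) x := by
  have key : F * X - (Polynomial.C A * G + Polynomial.C B * F + Polynomial.C C * H) = 0 :=
    eq_zero_of_mev_eq_zero fun y => by
      simpa [mev, eval_mul_X, eval_C_mul, sub_eq_zero] using h y
  have hd := congrArg (fun Q => mev (derivative Q) x) key
  simp only [mev, derivative_sub, derivative_add, derivative_mul, derivative_C, derivative_X,
    derivative_zero, zero_mul, zero_add, mul_one, eval_sub, eval_add, eval_mul_X, eval_C_mul,
    eval_zero, mul_smul_comm, sub_eq_zero] at hd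
  rw [add_comm]
  exact hd

/-- The telescoping step: the difference of two consecutive Christoffel–Darboux kernels. -/
theorem transpose_mul_self_eq_of_recurrence {p : ℕ}
    {F G H : Polynomial (Matrix (Fin p) (Fin p) ℝ)} {A B C : Matrix (Fin p) (Fin p) ℝ}
    (hA : A.IsSymm) (hB : B.IsSymm) (hC : C.IsSymm)
    (h : ∀ x : ℝ, x • mev F x = A * mev G x + B * mev F x + C * mev H x) (x : ℝ) :
    (mev F x)ᵀ * mev F x =
      ((mev (derivative G) x)ᵀ * A * mev F x - (mev (derivative F) x)ᵀ * A * mev G x) -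
        ((mev (derivative F) x)ᵀ * C * mev H x - (mev (derivative H) x)ᵀ * C * mev F x) := by
  have h1 := congrArg (fun M => Mᵀ * mev F x) (mev_derivative_of_recurrence h x)
  have h2 := congrArg (fun M => (mev (derivative F) x)ᵀ * M) (h x)
  simp only [transpose_add, transpose_mul, transpose_smul, hA.eq, hB.eq, hC.eq, add_mul, mul_add,
    smul_mul_assoc, mul_smul_comm, ← mul_assoc] at h1 h2
  rw [h2] at h1
  rw [eq_sub_of_add_eq h1]
  abel

/-- The confluent Christoffel–Darboux formula: for matrix orthonormal polynomials given
by a three-term recurrence `x Pₙ(x) = Dₙ₊₁ Pₙ₊₁(x) + Eₙ Pₙ(x) + Dₙ Pₙ₋₁(x)` with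
`P₋₁ = 0`, `P₀ = I`, the `Dₙ` symmetric invertible and the `Eₙ` symmetric, one has
`∑_{i=0}^{n} Pᵢ(x)ᵀ Pᵢ(x) = (Pₙ₊₁ᵀ)'(x) Dₙ₊₁ Pₙ(x) − (Pₙᵀ)'(x) Dₙ₊₁ Pₙ₊₁(x)`,
where the derivative is taken entrywise (i.e. it is the evaluation of the formal
derivative polynomial). -/
theorem confluent_christoffel_darboux {p : ℕ}
    (P : ℕ → Polynomial (Matrix (Fin p) (Fin p) ℝ))
    (D E : ℕ → Matrix (Fin p) (Fin p) ℝ)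
    (hP0 : P 0 = 1)
    (hDsymm : ∀ n, (D n).IsSymm) (hDinv : ∀ n, IsUnit (D n))
    (hE : ∀ n, (E n).IsSymm)
    (hrec0 : ∀ x : ℝ, x • mev (P 0) x = D 1 * mev (P 1) x + E 0 * mev (P 0) x)
    (hrec : ∀ (n : ℕ) (x : ℝ),
      x • mev (P (n + 1)) x =
        D (n + 2) * mev (P (n + 2)) x + E (n + 1) * mev (P (n + 1)) x +
          D (n + 1) * mev (P n) x) :
    ∀ (n : ℕ) (x : ℝ),
      ∑ i ∈ Finset.range (n + 1), (mev (P i) x)ᵀ * mev (P i) x =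
        (mev (derivative (P (n + 1))) x)ᵀ * D (n + 1) * mev (P n) x -
          (mev (derivative (P n)) x)ᵀ * D (n + 1) * mev (P (n + 1)) x := by
  intro n x
  induction n with
  | zero =>
    have h := transpose_mul_self_eq_of_recurrence (F := P 0) (G := P 1) (H := 0) (hDsymm 1) (hE 0)
      (hDsymm 0) (fun y => by simpa [mev] using hrec0 y) x
    simpa [mev, hP0] using h
  | succ n ih =>
    rw [Finset.sum_range_succ, ih, transpose_mul_self_eq_of_recurrence (hDsymm (n + 2))
      (hE (n + 1)) (hDsymm (n + 1)) (hrec n) x]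
    abel
end

section
/- Let P(x) = Σ_{j=0}^{m} A_j x^j be a p×p real matrix polynomial of degree m and let D(x) = Σ_{j=0}^{n} B_j x^j be a p×p real matrix polynomial of degree n whose leading coefficient B_n is invertible. Let X be a p×np real matrix and J an np×np real matrix such that the np×np block matrix col(XJ^l)_{l=0}^{n-1} (whose l-th block row is X·J^l) is invertible and Σ_{j=0}^{n} B_j · X · J^j = 0 (i.e., (X, J) is a standard/Jordan pair of D). Then there exists a matrix polynomial Q with P(x) = Q(x)·D(x) for all x if and only if Σ_{j=0}^{m} A_j · X · J^j = 0. -/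
open Polynomial Matrix

/-- The value `∑ Aⱼ X Jʲ` of the matrix polynomial `∑ Aⱼ xʲ` at the pair `(X, J)`. -/
noncomputable def pairEval {R ι κ : Type*} [Ring R] [Fintype ι] [DecidableEq ι] [Fintype κ]
    [DecidableEq κ] (X : Matrix ι κ R) (J : Matrix κ κ R) :
    Polynomial (Matrix ι ι R) →+ Matrix ι κ R where
  toFun P := P.sum fun j A => A * X * J ^ j
  map_zero' := by simp
  map_add' P Q := Polynomial.sum_add_index P Q _ (by simp) (by simp [Matrix.add_mul])

section pairEval

variable {R ι κ : Type*} [Ring R] [Fintype ι] [DecidableEq ι] [Fintype κ] [DecidableEq κ]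
  (X : Matrix ι κ R) (J : Matrix κ κ R)

theorem pairEval_eq_sum_range {N : ℕ} (P : Polynomial (Matrix ι ι R)) (hN : P.natDegree < N) :
    pairEval X J P = ∑ j ∈ Finset.range N, P.coeff j * X * J ^ j :=
  P.sum_over_range' (f := fun j A => A * X * J ^ j) (by simp) N hN

theorem pairEval_monomial (k : ℕ) (A : Matrix ι ι R) :
    pairEval X J (monomial k A) = A * X * J ^ k :=
  Polynomial.sum_monomial_index A (fun j A => A * X * J ^ j) (by simp)

theorem pairEval_monomial_mul (k : ℕ) (A : Matrix ι ι R) (D : Polynomial (Matrix ι ι R)) :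
    pairEval X J (monomial k A * D) = A * pairEval X J D * J ^ k := by
  induction D using Polynomial.induction_on' with
  | add D E hD hE => simp only [mul_add, map_add, hD, hE, Matrix.mul_add, Matrix.add_mul]
  | monomial l B =>
    simp only [monomial_mul_monomial, pairEval_monomial, Matrix.mul_assoc, ← pow_add, add_comm k l]

theorem pairEval_mul_eq_zero {D : Polynomial (Matrix ι ι R)} (hD : pairEval X J D = 0)
    (Q : Polynomial (Matrix ι ι R)) : pairEval X J (Q * D) = 0 := by
  induction Q using Polynomial.induction_on' with
  | add Q E hQ hE => rw [add_mul, map_add, hQ, hE, add_zero]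
  | monomial k A => rw [pairEval_monomial_mul, hD, Matrix.mul_zero, Matrix.zero_mul]

end pairEval

/-- Right division with remainder by a polynomial with invertible leading coefficient. -/
theorem exists_eq_mul_add_degree_lt {R : Type*} [Ring R] (D : Polynomial R)
    (hD : IsUnit D.leadingCoeff) (P : Polynomial R) :
    ∃ Q S : Polynomial R, P = Q * D + S ∧ ∀ j, D.natDegree ≤ j → S.coeff j = 0 := by
  obtain ⟨u, hu⟩ := hD
  suffices H : ∀ (N : ℕ) (P : Polynomial R), (∀ j, D.natDegree + N ≤ j → P.coeff j = 0) →
      ∃ Q S : Polynomial R, P = Q * D + S ∧ ∀ j, D.natDegree ≤ j → S.coeff j = 0 from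
    H (P.natDegree + 1) P fun j hj => coeff_eq_zero_of_natDegree_lt (by omega)
  intro N
  induction N with
  | zero => exact fun P hP => ⟨0, P, by simp, hP⟩
  | succ N ih =>
    intro P hP
    set M : Polynomial R := monomial N (P.coeff (D.natDegree + N) * ↑u⁻¹) with hM
    obtain ⟨Q, S, hQS, hS⟩ := ih (P - M * D) fun j hj => by
      obtain ⟨i, rfl⟩ := Nat.exists_eq_add_of_le hj
      have hc : (M * D).coeff (D.natDegree + N + i) =
          P.coeff (D.natDegree + N) * ↑u⁻¹ * D.coeff (D.natDegree + i) := by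
        rw [show D.natDegree + N + i = D.natDegree + i + N by omega, hM, coeff_monomial_mul]
      rw [coeff_sub, hc]
      rcases Nat.eq_zero_or_pos i with rfl | hi
      · rw [add_zero, add_zero, coeff_natDegree, ← hu, mul_assoc, Units.inv_mul, mul_one, sub_self]
      · rw [hP _ (by omega), coeff_eq_zero_of_natDegree_lt (p := D) (by omega), mul_zero, sub_zero]
    exact ⟨Q + M, S, by rw [add_mul, add_right_comm, ← hQS, sub_add_cancel], hS⟩

theorem eq_zero_of_pairEval_eq_zero {R : Type*} [CommRing R] {p n : ℕ}
    (X : Matrix (Fin p) (Fin n × Fin p) R) (J : Matrix (Fin n × Fin p) (Fin n × Fin p) R)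
    (hcol : IsUnit (Matrix.of fun (r c : Fin n × Fin p) => (X * J ^ (r.1 : ℕ)) r.2 c))
    (S : Polynomial (Matrix (Fin p) (Fin p) R)) (hS : ∀ j, n ≤ j → S.coeff j = 0)
    (h : pairEval X J S = 0) : S = 0 := by
  have hsum : ∑ j ∈ Finset.range n, S.coeff j * X * J ^ j = 0 := by
    rw [← h, pairEval_eq_sum_range X J (N := n + S.natDegree + 1) S (by omega)]
    refine Finset.sum_subset (Finset.range_subset_range.2 (by omega)) fun j _ hj => ?_
    rw [hS j (by simpa using hj), Matrix.zero_mul, Matrix.zero_mul]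
  let T : Matrix (Fin p) (Fin n × Fin p) R := Matrix.of fun i r => S.coeff r.1 i r.2
  have hT : T * (Matrix.of fun (r c : Fin n × Fin p) => (X * J ^ (r.1 : ℕ)) r.2 c) = 0 := by
    rw [← hsum]
    ext i c
    rw [Matrix.mul_apply, Fintype.sum_prod_type, Matrix.sum_apply, Finset.sum_range]
    exact Finset.sum_congr rfl fun l _ => by rw [Matrix.mul_assoc, Matrix.mul_apply]; rfl
  have hT0 : T = 0 := by
    obtain ⟨u, hu⟩ := hcol
    rw [← hu] at hT
    rw [← Matrix.mul_one T, ← Units.mul_inv u, ← Matrix.mul_assoc, hT, Matrix.zero_mul]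
  ext j i k
  rcases lt_or_ge j n with hj | hj
  · exact congrFun (congrFun hT0 i) (⟨j, hj⟩, k)
  · rw [hS j hj, coeff_zero]

theorem mev_mul {p : ℕ} (Q D : Polynomial (Matrix (Fin p) (Fin p) ℝ)) (x : ℝ) :
    mev (Q * D) x = mev Q x * mev D x := by
  unfold mev
  exact eval₂_mul_noncomm _ _ fun k => ((Commute.one_left _).smul_left x).symm

theorem mev_injective {p : ℕ} {P Q : Polynomial (Matrix (Fin p) (Fin p) ℝ)}
    (h : ∀ x, mev P x = mev Q x) : P = Q := by
  obtain ⟨M, rfl⟩ := matPolyEquiv.surjective P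
  obtain ⟨N, rfl⟩ := matPolyEquiv.surjective Q
  congr 1
  ext1 i j
  refine Polynomial.funext fun x => ?_
  have hx := congrFun (congrFun (h x) i) j
  simpa only [mev, Matrix.smul_one_eq_diagonal, ← Matrix.scalar_apply,
    matPolyEquiv_eval] using hx

/-- Let `P(x) = ∑ Aⱼ xʲ` have degree `m` and `D(x) = ∑ Bⱼ xʲ` have degree `n` with
invertible leading coefficient.  Let `(X, J)` be a standard (Jordan) pair of `D`, i.e.
the block matrix `col(X Jˡ)_{l=0}^{n-1}` (here indexed by `Fin n × Fin p`) is invertible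
and `∑ Bⱼ X Jʲ = 0`.  Then `D` is a right divisor of `P` iff `∑ Aⱼ X Jʲ = 0`. -/
theorem right_divisor_iff_jordan_pair {p n m : ℕ}
    (Pp Dp : Polynomial (Matrix (Fin p) (Fin p) ℝ))
    (hPdeg : Pp.natDegree = m) (hDdeg : Dp.natDegree = n)
    (hB : IsUnit Dp.leadingCoeff)
    (X : Matrix (Fin p) (Fin n × Fin p) ℝ)
    (J : Matrix (Fin n × Fin p) (Fin n × Fin p) ℝ)
    (hcol : IsUnit (Matrix.of fun (r c : Fin n × Fin p) => (X * J ^ (r.1 : ℕ)) r.2 c))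
    (hpair : ∑ j ∈ Finset.range (n + 1), Dp.coeff j * X * J ^ j = 0) :
    (∃ Q : Polynomial (Matrix (Fin p) (Fin p) ℝ),
        ∀ x : ℝ, mev Pp x = mev Q x * mev Dp x) ↔
      ∑ j ∈ Finset.range (m + 1), Pp.coeff j * X * J ^ j = 0 := by
  rw [← pairEval_eq_sum_range X J Dp (by omega)] at hpair
  rw [← pairEval_eq_sum_range X J Pp (by omega)]
  constructor
  · rintro ⟨Q, hQ⟩
    rw [mev_injective fun x => (hQ x).trans (mev_mul Q Dp x).symm]
    exact pairEval_mul_eq_zero X J hpair Q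
  · intro hP
    obtain ⟨Q, S, rfl, hS⟩ := exists_eq_mul_add_degree_lt Dp hB Pp
    rw [map_add, pairEval_mul_eq_zero X J hpair, zero_add] at hP
    rw [hDdeg] at hS
    refine ⟨Q, fun x => ?_⟩
    rw [eq_zero_of_pairEval_eq_zero X J hcol S hS hP, add_zero, mev_mul]
end

section
/- Let W be a weight matrix function on a finite interval [a,b], let (P_n)_{n≥0} be a sequence of orthonormal matrix polynomials with respect to W satisfying the three-term recurrence with symmetric positive definite matrices D_n, and let n ≥ 1. If x_0 ∈ ℝ and v_0 ∈ ℝ^p with v_0 ≠ 0 and P_n(x_0)·v_0 = 0, then there exists no vector v_1 ∈ ℝ^p with P_n'(x_0)·v_0 + P_n(x_0)·v_1 = 0; in other words, every Jordan chain of P_n has length 1. -/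
open Polynomial Matrix MeasureTheory

/-- Entrywise integral of a matrix-valued function over `[a, b]`. -/
noncomputable def mInt {p : ℕ} (a b : ℝ) (F : ℝ → Matrix (Fin p) (Fin p) ℝ) :
    Matrix (Fin p) (Fin p) ℝ :=
  Matrix.of fun i j => ∫ x in a..b, F x i j

/-- `W` is a weight matrix function on `[a, b]`: it takes symmetric values on `[a, b]`,
is measurable and (entrywise) integrable on `[a, b]`, is positive semidefinite almost
everywhere on `[a, b]`, and has nonzero determinant almost everywhere on `[a, b]`. -/
def IsWeight (p : ℕ) (a b : ℝ) (W : ℝ → Matrix (Fin p) (Fin p) ℝ) : Prop :=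
  (∀ x ∈ Set.Icc a b, (W x).IsSymm) ∧
  (∀ i j, Measurable fun x => W x i j) ∧
  (∀ i j, IntervalIntegrable (fun x => W x i j) volume a b) ∧
  (∀ᵐ x ∂volume.restrict (Set.Icc a b), (W x).PosSemidef) ∧
  (∀ᵐ x ∂volume.restrict (Set.Icc a b), (W x).det ≠ 0)

/-- `P` is a sequence of orthonormal matrix polynomials with respect to the weight
matrix `W` on `[a, b]`: `deg Pₙ = n`, the leading coefficients are invertible,
`P₀ = I` and `∫_a^b Pₙ(x) W(x) Pₘ(x)ᵀ dx = δₙₘ I`. -/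
def IsOrthonormal (p : ℕ) (a b : ℝ) (W : ℝ → Matrix (Fin p) (Fin p) ℝ)
    (P : ℕ → Polynomial (Matrix (Fin p) (Fin p) ℝ)) : Prop :=
  (∀ n, (P n).natDegree = n) ∧ (∀ n, IsUnit (P n).leadingCoeff) ∧ P 0 = 1 ∧
  ∀ n m : ℕ,
    mInt a b (fun x => mev (P n) x * W x * (mev (P m) x)ᵀ) =
      if n = m then 1 else 0

/-- The entries of `mev P` are differentiable, with derivative the entries of
`mev (derivative P)`. -/
theorem hasDerivAt_mev {p : ℕ} (P : Polynomial (Matrix (Fin p) (Fin p) ℝ)) (x : ℝ)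
    (i j : Fin p) :
    HasDerivAt (fun y => mev P y i j) (mev (derivative P) x i j) x := by
  induction P using Polynomial.induction_on' with
  | add P Q hP hQ =>
    simpa [mev, eval_add, Matrix.add_apply] using hP.fun_add hQ
  | monomial k A =>
    have h := (hasDerivAt_pow k x).mul_const (A i j)
    have hA : A * (k : Matrix (Fin p) (Fin p) ℝ) = (k : ℝ) • A := by
      rw [← nsmul_eq_mul', Nat.cast_smul_eq_nsmul]
    rw [derivative_monomial, hA]
    simpa [mev, eval_monomial, _root_.smul_pow, mul_comm, mul_left_comm] using h

/-- Constant matrices pass through the entrywise derivative of a matrix polynomial. -/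
theorem hasDerivAt_const_mul_mev {p : ℕ} (A : Matrix (Fin p) (Fin p) ℝ)
    (P : Polynomial (Matrix (Fin p) (Fin p) ℝ)) (x : ℝ) (i j : Fin p) :
    HasDerivAt (fun y => (A * mev P y) i j) ((A * mev (derivative P) x) i j) x := by
  simp only [Matrix.mul_apply]
  exact HasDerivAt.fun_sum fun l _ => (hasDerivAt_mev P x l j).const_mul (A i l)

/-- Entrywise product rule for `x • P x`. -/
theorem hasDerivAt_smul_mev {p : ℕ} (P : Polynomial (Matrix (Fin p) (Fin p) ℝ)) (x : ℝ)
    (i j : Fin p) :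
    HasDerivAt (fun y => (y • mev P y) i j) ((mev P x + x • mev (derivative P) x) i j) x := by
  simpa using (hasDerivAt_id x).fun_mul (hasDerivAt_mev P x i j)

/-- A symmetric matrix can be moved across the dot product. -/
theorem Matrix.IsSymm.dotProduct_mulVec_comm {p : ℕ} {A : Matrix (Fin p) (Fin p) ℝ}
    (hA : A.IsSymm) (u v : Fin p → ℝ) : u ⬝ᵥ A *ᵥ v = v ⬝ᵥ A *ᵥ u := by
  rw [Matrix.dotProduct_mulVec, ← Matrix.mulVec_transpose, hA.eq, dotProduct_comm]

/-- Confluent Christoffel–Darboux formula along solutions `a` of a symmetric three-term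
recurrence at `x` and `u` of the differentiated recurrence. -/
theorem sum_dotProduct_self_eq_of_recurrence {p : ℕ} {D E : ℕ → Matrix (Fin p) (Fin p) ℝ}
    (hD : ∀ n, (D n).IsSymm) (hE : ∀ n, (E n).IsSymm) (x : ℝ) (a u : ℕ → Fin p → ℝ)
    (ha0 : x • a 0 = D 1 *ᵥ a 1 + E 0 *ᵥ a 0)
    (ha : ∀ n, x • a (n + 1) =
      D (n + 2) *ᵥ a (n + 2) + E (n + 1) *ᵥ a (n + 1) + D (n + 1) *ᵥ a n)
    (hu0 : a 0 + x • u 0 = D 1 *ᵥ u 1 + E 0 *ᵥ u 0)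
    (hu : ∀ n, a (n + 1) + x • u (n + 1) =
      D (n + 2) *ᵥ u (n + 2) + E (n + 1) *ᵥ u (n + 1) + D (n + 1) *ᵥ u n) (n : ℕ) :
    ∑ k ∈ Finset.range (n + 1), a k ⬝ᵥ a k =
      a n ⬝ᵥ D (n + 1) *ᵥ u (n + 1) - u n ⬝ᵥ D (n + 1) *ᵥ a (n + 1) := by
  induction n with
  | zero =>
    have h1 := congrArg (u 0 ⬝ᵥ ·) ha0
    have h2 := congrArg (a 0 ⬝ᵥ ·) hu0
    simp only [dotProduct_add, dotProduct_smul, smul_eq_mul] at h1 h2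
    have h3 := (hE 0).dotProduct_mulVec_comm (a 0) (u 0)
    rw [dotProduct_comm (u 0) (a 0)] at h1
    simp only [zero_add, Finset.sum_range_one]
    linarith
  | succ n ih =>
    have h1 := congrArg (u (n + 1) ⬝ᵥ ·) (ha n)
    have h2 := congrArg (a (n + 1) ⬝ᵥ ·) (hu n)
    simp only [dotProduct_add, dotProduct_smul, smul_eq_mul] at h1 h2
    have h3 := (hE (n + 1)).dotProduct_mulVec_comm (a (n + 1)) (u (n + 1))
    have h4 := (hD (n + 1)).dotProduct_mulVec_comm (a (n + 1)) (u n)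
    have h5 := (hD (n + 1)).dotProduct_mulVec_comm (u (n + 1)) (a n)
    rw [dotProduct_comm (u (n + 1)) (a (n + 1))] at h1
    rw [Finset.sum_range_succ, ih]
    simp only [add_assoc, Nat.reduceAdd] at *
    linarith

/-- Every Jordan chain of the orthonormal matrix polynomial `Pₙ` (`n ≥ 1`) has length
one: if `v₀ ≠ 0` and `Pₙ(x₀) v₀ = 0`, there is no `v₁` with
`Pₙ'(x₀) v₀ + Pₙ(x₀) v₁ = 0`.  Here `(Pₙ)` satisfies the three-term recurrence
`x Pₙ(x) = Dₙ₊₁ Pₙ₊₁(x) + Eₙ Pₙ(x) + Dₙ Pₙ₋₁(x)` (with `P₋₁ = 0`), the `Dₙ`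
symmetric positive definite and the `Eₙ` symmetric. -/
theorem jordan_chain_length_one {p : ℕ} (a b : ℝ)
    (W : ℝ → Matrix (Fin p) (Fin p) ℝ) (hW : IsWeight p a b W)
    (P : ℕ → Polynomial (Matrix (Fin p) (Fin p) ℝ))
    (hP : IsOrthonormal p a b W P)
    (D E : ℕ → Matrix (Fin p) (Fin p) ℝ)
    (hD : ∀ n, (D n).PosDef) (hE : ∀ n, (E n).IsSymm)
    (hrec0 : ∀ x : ℝ, x • mev (P 0) x = D 1 * mev (P 1) x + E 0 * mev (P 0) x)
    (hrec : ∀ (n : ℕ) (x : ℝ),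
      x • mev (P (n + 1)) x =
        D (n + 2) * mev (P (n + 2)) x + E (n + 1) * mev (P (n + 1)) x +
          D (n + 1) * mev (P n) x)
    (n : ℕ) (hn : 1 ≤ n) (x₀ : ℝ) (v₀ : Fin p → ℝ) (hv₀ : v₀ ≠ 0)
    (hker : mev (P n) x₀ *ᵥ v₀ = 0) :
    ¬ ∃ v₁ : Fin p → ℝ,
        mev (derivative (P n)) x₀ *ᵥ v₀ + mev (P n) x₀ *ᵥ v₁ = 0 := by
  rintro ⟨v₁, hv₁⟩
  obtain ⟨-, -, hP0, -⟩ := hP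
  have hDs (k) : (D k).IsSymm := by simpa using (hD k).isHermitian
  have hrec0' : mev (P 0) x₀ + x₀ • mev (derivative (P 0)) x₀ =
      D 1 * mev (derivative (P 1)) x₀ + E 0 * mev (derivative (P 0)) x₀ := by
    ext i j
    refine (hasDerivAt_smul_mev (P 0) x₀ i j).unique ?_
    simp only [hrec0, Matrix.add_apply]
    exact (hasDerivAt_const_mul_mev _ _ _ _ _).fun_add (hasDerivAt_const_mul_mev _ _ _ _ _)
  have hrec' (k) : mev (P (k + 1)) x₀ + x₀ • mev (derivative (P (k + 1))) x₀ =
      D (k + 2) * mev (derivative (P (k + 2))) x₀ +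
        E (k + 1) * mev (derivative (P (k + 1))) x₀ +
          D (k + 1) * mev (derivative (P k)) x₀ := by
    ext i j
    refine (hasDerivAt_smul_mev (P (k + 1)) x₀ i j).unique ?_
    simp only [hrec, Matrix.add_apply]
    exact ((hasDerivAt_const_mul_mev _ _ _ _ _).fun_add
      (hasDerivAt_const_mul_mev _ _ _ _ _)).fun_add (hasDerivAt_const_mul_mev _ _ _ _ _)
  obtain ⟨m, rfl⟩ := Nat.exists_eq_add_of_le' hn
  have hsum := sum_dotProduct_self_eq_of_recurrence hDs hE x₀
    (fun k => mev (P k) x₀ *ᵥ v₀)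
    (fun k => mev (derivative (P k)) x₀ *ᵥ v₀ + mev (P k) x₀ *ᵥ v₁)
    (by simpa [add_mulVec, smul_mulVec] using congrArg (· *ᵥ v₀) (hrec0 x₀))
    (fun k => by simpa [add_mulVec, smul_mulVec] using congrArg (· *ᵥ v₀) (hrec k x₀))
    (by
      have h1 := congrArg (· *ᵥ v₀) hrec0'
      have h2 := congrArg (· *ᵥ v₁) (hrec0 x₀)
      simp only [add_mulVec, smul_mulVec, ← mulVec_mulVec] at h1 h2
      rw [smul_add, h2, ← add_assoc, h1]
      simp only [mulVec_add]
      abel)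
    (fun k => by
      have h1 := congrArg (· *ᵥ v₀) (hrec' k)
      have h2 := congrArg (· *ᵥ v₁) (hrec k x₀)
      simp only [add_mulVec, smul_mulVec, ← mulVec_mulVec] at h1 h2
      rw [smul_add, h2, ← add_assoc, h1]
      simp only [mulVec_add]
      abel) m
  simp only [hv₁, hker, mulVec_zero, dotProduct_zero, sub_zero] at hsum
  have hnonneg : ∀ k ∈ Finset.range (m + 1),
      0 ≤ (mev (P k) x₀ *ᵥ v₀) ⬝ᵥ (mev (P k) x₀ *ᵥ v₀) :=
    fun k _ => Finset.sum_nonneg fun i _ => mul_self_nonneg _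
  have h0 := (Finset.sum_eq_zero_iff_of_nonneg hnonneg).1 hsum 0 (by simp)
  rw [dotProduct_self_eq_zero, hP0] at h0
  exact hv₀ (by simpa [mev] using h0)
end

section
/- Let x_1,...,x_k be distinct real numbers. For each i = 1,...,k let there be given chains of vectors v^{(i)}_{t,q} ∈ ℝ^p for t = 1,...,s_i and q = 0,...,μ_t^{(i)}−1, with Σ_{i=1}^k Σ_{t=1}^{s_i} μ_t^{(i)} = np. Let X be the p×np matrix whose columns are the vectors v^{(i)}_{t,q} (ordered by i, then t, then q), and let J be the np×np block-diagonal matrix whose blocks are the upper-triangular Jordan blocks of size μ_t^{(i)} with eigenvalue x_i, in the same order. Assume the np×np matrix col(XJ^l)_{l=0}^{n-1} (whose l-th block row is X·J^l) is invertible. If P_1 and P_2 are p×p matrix polynomials of degree at most n−1 such that Σ_{l=0}^{q} (1/l!)·P_1^{(l)}(x_i)·v^{(i)}_{t,q−l} = Σ_{l=0}^{q} (1/l!)·P_2^{(l)}(x_i)·v^{(i)}_{t,q−l} for all i, t and all q = 0,...,μ_t^{(i)}−1, then P_1 = P_2. -/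
open Polynomial Matrix

/-- The index type of the columns of `X`: the vector `v^{(i)}_{t,q}` corresponds to the
index `⟨i, t, q⟩` (ordered by `i`, then `t`, then `q`). -/
abbrev ChainIdx (k : ℕ) (s : Fin k → ℕ) (μ : (i : Fin k) → Fin (s i) → ℕ) : Type :=
  (i : Fin k) × (t : Fin (s i)) × Fin (μ i t)

/-- The block matrix `col(X Jˡ)_{l=0}^{n-1}` for the matrix `X` whose columns are the
chain vectors `v^{(i)}_{t,q}` and the block-diagonal matrix `J` built from the
upper-triangular Jordan blocks of sizes `μ_t^{(i)}` with eigenvalues `x_i`: its entry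
in block row `l`, row `r`, column `⟨i,t,q⟩` is
`∑_{j=0}^{q} (l choose j) x_iˡ⁻ʲ v^{(i)}_{t,q-j}(r)`, which is the `(r, ⟨i,t,q⟩)`
entry of `X Jˡ`. -/
noncomputable def colChains {p n k : ℕ} (x : Fin k → ℝ) (s : Fin k → ℕ)
    (μ : (i : Fin k) → Fin (s i) → ℕ)
    (v : (i : Fin k) → (t : Fin (s i)) → Fin (μ i t) → Fin p → ℝ) :
    Matrix (Fin n × Fin p) (ChainIdx k s μ) ℝ :=
  Matrix.of fun lr a =>
    ∑ j ∈ Finset.range ((a.2.2 : ℕ) + 1),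
      ((lr.1 : ℕ).choose j : ℝ) * x a.1 ^ ((lr.1 : ℕ) - j) *
        v a.1 a.2.1 ⟨(a.2.2 : ℕ) - j, lt_of_le_of_lt (Nat.sub_le _ _) a.2.2.isLt⟩ lr.2

/-- The normalized derivatives of a matrix polynomial, evaluated at a scalar, in terms of
its coefficients. -/
theorem inv_factorial_smul_mev_iterate_derivative {p n : ℕ}
    {P : Polynomial (Matrix (Fin p) (Fin p) ℝ)} (hd : P.degree < (n : ℕ)) (j : ℕ) (x : ℝ) :
    (1 / (j.factorial : ℝ)) • mev (derivative^[j] P) x =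
      ∑ l : Fin n, (((l : ℕ).choose j : ℝ) * x ^ ((l : ℕ) - j)) • P.coeff l := by
  have hj : (j.factorial : ℝ) ≠ 0 := Nat.cast_ne_zero.2 j.factorial_ne_zero
  have hP : P = ∑ l ∈ Finset.range n, monomial l (P.coeff l) := by
    ext1 m
    by_cases hm : m < n
    · simp [finsetSum_coeff, coeff_monomial, hm]
    · have hm' : P.coeff m = 0 :=
        coeff_eq_zero_of_degree_lt (hd.trans_le (by exact_mod_cast not_lt.1 hm))
      simp [finsetSum_coeff, coeff_monomial, hm, hm']
  have hder : derivative^[j] P = j.factorial • hasseDeriv j P := by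
    rw [← factorial_smul_hasseDeriv]
    rfl
  have hfac : mev (derivative^[j] P) x = (j.factorial : ℝ) • mev (hasseDeriv j P) x := by
    rw [hder, mev, mev, eval_smul, Nat.cast_smul_eq_nsmul]
  rw [hfac, smul_smul, one_div, inv_mul_cancel₀ hj, one_smul, mev,
    Fin.sum_univ_eq_sum_range
      (fun l : ℕ => ((l.choose j : ℝ) * x ^ (l - j)) • P.coeff l) n]
  conv_lhs => rw [hP]
  rw [map_sum, eval_finsetSum]
  refine Finset.sum_congr rfl fun l _ => ?_
  rw [hasseDeriv_monomial, eval_monomial, _root_.smul_pow, one_pow, mul_smul_comm, mul_one,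
    mul_comm (l.choose j : ℝ), mul_smul, ← nsmul_eq_mul, Nat.cast_smul_eq_nsmul]

/-- The left-hand sides of the interpolation conditions are the products of the rows of
coefficients of `P` with the block matrix `col(X Jˡ)`. -/
theorem vecMul_colChains {p n k : ℕ} (x : Fin k → ℝ) (s : Fin k → ℕ)
    (μ : (i : Fin k) → Fin (s i) → ℕ)
    (v : (i : Fin k) → (t : Fin (s i)) → Fin (μ i t) → Fin p → ℝ)
    {P : Polynomial (Matrix (Fin p) (Fin p) ℝ)} (hd : P.degree < (n : ℕ)) (r : Fin p)
    (i : Fin k) (t : Fin (s i)) (q : Fin (μ i t)) :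
    ((fun lc : Fin n × Fin p => P.coeff lc.1 r lc.2) ᵥ* colChains x s μ v) ⟨i, t, q⟩ =
      (∑ l ∈ Finset.range ((q : ℕ) + 1),
          (1 / (l.factorial : ℝ)) •
            (mev (derivative^[l] P) (x i) *ᵥ
              v i t ⟨(q : ℕ) - l, lt_of_le_of_lt (Nat.sub_le _ _) q.isLt⟩)) r := by
  simp only [← Matrix.smul_mulVec, inv_factorial_smul_mev_iterate_derivative hd]
  simp only [vecMul, dotProduct, colChains, of_apply, Finset.sum_apply, mulVec, Matrix.sum_apply,
    Matrix.smul_apply, smul_eq_mul, Finset.mul_sum, Finset.sum_mul]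
  rw [Finset.sum_comm]
  refine Finset.sum_congr rfl fun j _ => ?_
  rw [Fintype.sum_prod_type_right]
  exact Finset.sum_congr rfl fun c _ => Finset.sum_congr rfl fun l _ => by ring

/-- Uniqueness of the general (Hermite-type) polynomial interpolation problem: if the
block matrix `col(X Jˡ)_{l=0}^{n-1}` associated with distinct points `x₁, …, x_k` and
chains of vectors `v^{(i)}_{t,q}` (with `∑ μ_t^{(i)} = np`) is invertible, then two
matrix polynomials of degree at most `n − 1` satisfying the same interpolation
conditions `∑_{l=0}^{q} (1/l!) P⁽ˡ⁾(x_i) v^{(i)}_{t,q−l}` coincide. -/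
theorem interpolation_unique {p n k : ℕ} (x : Fin k → ℝ) (hx : Function.Injective x)
    (s : Fin k → ℕ) (μ : (i : Fin k) → Fin (s i) → ℕ)
    (v : (i : Fin k) → (t : Fin (s i)) → Fin (μ i t) → Fin p → ℝ)
    (hsum : (∑ i, ∑ t, μ i t) = n * p)
    (e : (Fin n × Fin p) ≃ ChainIdx k s μ)
    (hinv : IsUnit ((colChains x s μ v (n := n)).submatrix id e))
    (P₁ P₂ : Polynomial (Matrix (Fin p) (Fin p) ℝ))
    (hd₁ : P₁.degree < (n : ℕ)) (hd₂ : P₂.degree < (n : ℕ))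
    (hinterp : ∀ (i : Fin k) (t : Fin (s i)) (q : Fin (μ i t)),
      ∑ l ∈ Finset.range ((q : ℕ) + 1),
          (1 / (l.factorial : ℝ)) •
            (mev (derivative^[l] P₁) (x i) *ᵥ
              v i t ⟨(q : ℕ) - l, lt_of_le_of_lt (Nat.sub_le _ _) q.isLt⟩) =
        ∑ l ∈ Finset.range ((q : ℕ) + 1),
          (1 / (l.factorial : ℝ)) •
            (mev (derivative^[l] P₂) (x i) *ᵥ
              v i t ⟨(q : ℕ) - l, lt_of_le_of_lt (Nat.sub_le _ _) q.isLt⟩)) :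
    P₁ = P₂ := by
  have hvec (r : Fin p) :
      (fun lc : Fin n × Fin p => P₁.coeff lc.1 r lc.2) =
        fun lc : Fin n × Fin p => P₂.coeff lc.1 r lc.2 := by
    refine Matrix.vecMul_injective_of_isUnit hinv (funext fun lc => ?_)
    have h : ∀ a : ChainIdx k s μ,
        ((fun lc : Fin n × Fin p => P₁.coeff lc.1 r lc.2) ᵥ* colChains x s μ v) a =
          ((fun lc : Fin n × Fin p => P₂.coeff lc.1 r lc.2) ᵥ* colChains x s μ v) a := by
      rintro ⟨i, t, q⟩
      rw [vecMul_colChains x s μ v hd₁, vecMul_colChains x s μ v hd₂, hinterp]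
    exact h (e lc)
  ext1 m
  by_cases hm : m < n
  · ext r c
    exact congrFun (hvec r) (⟨m, hm⟩, c)
  · have hnm : ((n : ℕ) : WithBot ℕ) ≤ m := by exact_mod_cast not_lt.1 hm
    rw [coeff_eq_zero_of_degree_lt (hd₁.trans_le hnm),
      coeff_eq_zero_of_degree_lt (hd₂.trans_le hnm)]
end

section
/- Let x_1,...,x_k be distinct real numbers with positive integers m_1,...,m_k satisfying Σ_{i=1}^k m_i = np, and for each i let v_{i,1},...,v_{i,m_i} ∈ ℝ^p be nonzero linearly independent vectors. Let X = (v_{1,1} ... v_{1,m_1} ... v_{k,1} ... v_{k,m_k}) be the p×np matrix of these columns and let J be the np×np diagonal matrix with x_i repeated m_i times, in the same order. Assume col(XJ^l)_{l=0}^{n-1} is invertible and let (V_1 V_2 ... V_n) = (col(XJ^l)_{l=0}^{n-1})^{-1} be its inverse partitioned into np×p block columns V_j. For any function F : ℝ → ℝ^{p×p}, define the matrix polynomial P(x) = Σ_{i=1}^{k} F(x_i)·X_i^0·(V_1 + V_2·x + ... + V_n·x^{n-1}), where X_i^0 is the p×np matrix obtained from X by replacing by zero all columns except those in positions m_1+...+m_{i-1}+1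 through m_1+...+m_i. Then P has degree at most n−1 and P(x_i)·v_{i,j} = F(x_i)·v_{i,j} for all j = 1,...,m_i and i = 1,...,k. -/
open Polynomial Matrix

/-- Index type for the columns of `X`: the vector `v_{i,j}` corresponds to the index
`⟨i, j⟩` (the columns are ordered by `i`, then `j`). -/
abbrev LagIdx (k : ℕ) (m : Fin k → ℕ) : Type := (i : Fin k) × Fin (m i)

/-- The `p × np` matrix `X` whose columns are the vectors `v_{i,j}`. -/
def Xmat {p k : ℕ} (m : Fin k → ℕ) (v : (i : Fin k) → Fin (m i) → Fin p → ℝ) :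
    Matrix (Fin p) (LagIdx k m) ℝ :=
  Matrix.of fun r a => v a.1 a.2 r

/-- The `np × np` diagonal matrix `J` with `x_i` repeated `m_i` times. -/
noncomputable def Jmat {k : ℕ} (x : Fin k → ℝ) (m : Fin k → ℕ) :
    Matrix (LagIdx k m) (LagIdx k m) ℝ :=
  Matrix.diagonal fun a => x a.1

/-- The `np × np` block matrix `col(X Jˡ)_{l=0}^{n-1}` whose `l`-th block row is
`X Jˡ`, realized as a square matrix via the identification
`e : Fin n × Fin p ≃ LagIdx k m` of the column indices. -/
noncomputable def colLag {p n k : ℕ} (x : Fin k → ℝ) (m : Fin k → ℕ)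
    (v : (i : Fin k) → Fin (m i) → Fin p → ℝ)
    (e : (Fin n × Fin p) ≃ LagIdx k m) :
    Matrix (Fin n × Fin p) (Fin n × Fin p) ℝ :=
  Matrix.of fun lr c => (Xmat m v * Jmat x m ^ (lr.1 : ℕ)) lr.2 (e c)

/-- The `np × p` block columns `V₁, …, Vₙ` of the inverse of `col(X Jˡ)_{l=0}^{n-1}`:
`Vblock x m v e j` is the block `V_{j+1}`, with rows indexed by `LagIdx k m`
(the column index type of `col(X Jˡ)` itself). -/
noncomputable def Vblock {p n k : ℕ} (x : Fin k → ℝ) (m : Fin k → ℕ)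
    (v : (i : Fin k) → Fin (m i) → Fin p → ℝ)
    (e : (Fin n × Fin p) ≃ LagIdx k m) (j : Fin n) :
    Matrix (LagIdx k m) (Fin p) ℝ :=
  Matrix.of fun a c => (colLag x m v e)⁻¹ (e.symm a) (j, c)

/-- The matrix `X_i⁰` obtained from `X` by replacing by zero all columns except those
corresponding to the vectors `v_{i,1}, …, v_{i,m_i}`. -/
def XmatZero {p k : ℕ} (m : Fin k → ℕ) (v : (i : Fin k) → Fin (m i) → Fin p → ℝ)
    (i : Fin k) : Matrix (Fin p) (LagIdx k m) ℝ :=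
  Matrix.of fun r a => if a.1 = i then v a.1 a.2 r else 0

theorem mev_sum_monomial {p n : ℕ} (A : Fin n → Matrix (Fin p) (Fin p) ℝ) (t : ℝ) :
    mev (∑ j : Fin n, monomial (j : ℕ) (A j)) t = ∑ j : Fin n, t ^ (j : ℕ) • A j := by
  simp [mev, eval_finsetSum, _root_.smul_pow]

theorem colLag_apply {p n k : ℕ} (x : Fin k → ℝ) (m : Fin k → ℕ)
    (v : (i : Fin k) → Fin (m i) → Fin p → ℝ) (e : (Fin n × Fin p) ≃ LagIdx k m)
    (l : Fin n) (r : Fin p) (c : Fin n × Fin p) :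
    colLag x m v e (l, r) c = v (e c).1 (e c).2 r * x (e c).1 ^ (l : ℕ) := by
  simp [colLag, Xmat, Jmat, diagonal_pow]

theorem sum_pow_smul_Vblock_mulVec {p n k : ℕ} (x : Fin k → ℝ) (m : Fin k → ℕ)
    (v : (i : Fin k) → Fin (m i) → Fin p → ℝ) (e : (Fin n × Fin p) ≃ LagIdx k m)
    (hinv : IsUnit (colLag x m v e)) (a : LagIdx k m) :
    (∑ j : Fin n, x a.1 ^ (j : ℕ) • Vblock x m v e j) *ᵥ v a.1 a.2 = Pi.single a 1 := by
  obtain ⟨c, rfl⟩ := e.surjective a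
  ext b
  have h := congrFun₂ (nonsing_inv_mul _ ((isUnit_iff_isUnit_det _).mp hinv)) (e.symm b) c
  rw [mul_apply, Fintype.sum_prod_type] at h
  simp only [colLag_apply, one_apply, e.symm_apply_eq] at h
  rw [Pi.single_apply, ← h, sum_mulVec, Finset.sum_apply]
  refine Finset.sum_congr rfl fun j _ => ?_
  rw [smul_mulVec, Pi.smul_apply, mulVec, dotProduct, Finset.smul_sum]
  refine Finset.sum_congr rfl fun r _ => ?_
  simp only [Vblock, of_apply, smul_eq_mul]
  ring

theorem XmatZero_mulVec_single {p k : ℕ} (m : Fin k → ℕ)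
    (v : (i : Fin k) → Fin (m i) → Fin p → ℝ) (i : Fin k) (a : LagIdx k m) :
    XmatZero m v i *ᵥ Pi.single a 1 = if a.1 = i then v a.1 a.2 else 0 := by
  ext r
  rw [mulVec_single_one]
  by_cases h : a.1 = i <;> simp [XmatZero, h]

/-- Solution of the Lagrange interpolation problem: for distinct points `x₁, …, x_k`
with multiplicities `m_i` (`∑ m_i = np`), nonzero linearly independent vectors
`v_{i,j}` and invertible `col(X Jˡ)_{l=0}^{n-1}` with inverse blocks `V₁, …, Vₙ`, the
matrix polynomial `P(x) = ∑_i F(x_i) X_i⁰ (V₁ + V₂ x + ⋯ + Vₙ xⁿ⁻¹)` has degree at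
most `n − 1` and satisfies `P(x_i) v_{i,j} = F(x_i) v_{i,j}`. -/
theorem lagrange_interpolation {p n k : ℕ}
    (x : Fin k → ℝ) (hx : Function.Injective x)
    (m : Fin k → ℕ) (hm : ∀ i, 0 < m i) (hsum : (∑ i, m i) = n * p)
    (v : (i : Fin k) → Fin (m i) → Fin p → ℝ)
    (hv0 : ∀ i j, v i j ≠ 0) (hv : ∀ i, LinearIndependent ℝ (v i))
    (e : (Fin n × Fin p) ≃ LagIdx k m)
    (hinv : IsUnit (colLag x m v e (n := n)))
    (F : ℝ → Matrix (Fin p) (Fin p) ℝ) :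
    (∃ Q : Polynomial (Matrix (Fin p) (Fin p) ℝ), Q.degree < (n : ℕ) ∧
        ∀ t : ℝ, mev Q t =
          ∑ i, F (x i) *
            (XmatZero m v i * ∑ j : Fin n, t ^ (j : ℕ) • Vblock x m v e j)) ∧
      ∀ (i : Fin k) (j : Fin (m i)),
        (∑ i', F (x i') *
            (XmatZero m v i' * ∑ j' : Fin n, x i ^ (j' : ℕ) • Vblock x m v e j'))
          *ᵥ v i j = F (x i) *ᵥ v i j := by
  refine ⟨⟨∑ j : Fin n, monomial (j : ℕ) (∑ i, F (x i) * (XmatZero m v i * Vblock x m v e j)),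
    ?_, fun t => ?_⟩, fun i j => ?_⟩
  · rw [← mem_degreeLT]
    exact Submodule.sum_mem _ fun j _ => mem_degreeLT.mpr <|
      (degree_monomial_le _ _).trans_lt (by exact_mod_cast j.isLt)
  · rw [mev_sum_monomial]
    simp only [Finset.smul_sum, Matrix.mul_sum, Matrix.mul_smul]
    exact Finset.sum_comm
  · have key := sum_pow_smul_Vblock_mulVec x m v e hinv ⟨i, j⟩
    simp only at key
    simp only [sum_mulVec, ← mulVec_mulVec]
    simp only [← sum_mulVec, key, XmatZero_mulVec_single]
    rw [Finset.sum_eq_single i (fun i' _ h => by simp [h.symm]) (by simp)]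
    simp
end

section
/- Let X be a p×np real matrix and T an np×np real matrix such that S = col(XT^l)_{l=0}^{n-1} is invertible, and let V_1,...,V_n be the np×p block columns of S^{-1}, i.e., S^{-1} = (V_1 V_2 ... V_n). Then T·V_1 − V_n·X·T^n·V_1 = 0 and T·V_i − V_n·X·T^n·V_i = V_{i-1} for i = 2,...,n. -/
open Matrix

/-- The `np × np` block matrix `S = col(X Tˡ)_{l=0}^{n-1}` whose `l`-th block row is
`X Tˡ` (the `np`-dimensional index set is realized as `Fin n × Fin p`). -/
noncomputable def colStd {p n : ℕ} (X : Matrix (Fin p) (Fin n × Fin p) ℝ)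
    (T : Matrix (Fin n × Fin p) (Fin n × Fin p) ℝ) :
    Matrix (Fin n × Fin p) (Fin n × Fin p) ℝ :=
  Matrix.of fun lr c => (X * T ^ (lr.1 : ℕ)) lr.2 c

/-- The `np × p` block columns `V₁, …, Vₙ` of `S⁻¹`: `Vstd X T j` is `V_{j+1}`. -/
noncomputable def Vstd {p n : ℕ} (X : Matrix (Fin p) (Fin n × Fin p) ℝ)
    (T : Matrix (Fin n × Fin p) (Fin n × Fin p) ℝ) (j : Fin n) :
    Matrix (Fin n × Fin p) (Fin p) ℝ :=
  Matrix.of fun a c => (colStd X T)⁻¹ a (j, c)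

/-- The `k`-th block row of `S * A` is `X * T ^ k * A`. -/
theorem colStd_mul_apply {p n : ℕ} {m : Type*} (X : Matrix (Fin p) (Fin n × Fin p) ℝ)
    (T : Matrix (Fin n × Fin p) (Fin n × Fin p) ℝ) (A : Matrix (Fin n × Fin p) m ℝ)
    (k : Fin n) (r : Fin p) (c : m) :
    (colStd X T * A) (k, r) c = (X * T ^ (k : ℕ) * A) r c := rfl

/-- Multiplication by an invertible `S` is injective, checked block row by block row. -/
theorem eq_of_colStd_blocks_mul_eq {p n : ℕ} {m : Type*} {X : Matrix (Fin p) (Fin n × Fin p) ℝ}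
    {T : Matrix (Fin n × Fin p) (Fin n × Fin p) ℝ} (hS : IsUnit (colStd X T))
    {A B : Matrix (Fin n × Fin p) m ℝ}
    (h : ∀ k : Fin n, X * T ^ (k : ℕ) * A = X * T ^ (k : ℕ) * B) : A = B := by
  have hdet := (isUnit_iff_isUnit_det _).1 hS
  have hmul : colStd X T * A = colStd X T * B := by
    ext ⟨k, r⟩ c
    rw [colStd_mul_apply, colStd_mul_apply, h]
  rw [← nonsing_inv_mul_cancel_left (colStd X T) A hdet, hmul,
    nonsing_inv_mul_cancel_left _ _ hdet]

/-- The block form of `S * S⁻¹ = 1`. -/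
theorem mul_pow_mul_Vstd {p n : ℕ} {X : Matrix (Fin p) (Fin n × Fin p) ℝ}
    {T : Matrix (Fin n × Fin p) (Fin n × Fin p) ℝ} (hS : IsUnit (colStd X T)) (k j : Fin n) :
    X * T ^ (k : ℕ) * Vstd X T j = if k = j then 1 else 0 := by
  ext r c
  have h := congrFun₂ (mul_nonsing_inv _ ((isUnit_iff_isUnit_det _).1 hS)) (k, r) (j, c)
  rw [colStd_mul_apply] at h
  refine Eq.trans (show _ = (X * T ^ (k : ℕ) * (colStd X T)⁻¹) r (j, c) from rfl) (h.trans ?_)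
  by_cases hkj : k = j <;> simp [one_apply, hkj]

/-- The block rows of `S * (T * Vᵢ - Vₙ * X * T ^ n * Vᵢ)`. -/
theorem mul_pow_mul_shift_Vstd {p n : ℕ} (hn : 0 < n) {X : Matrix (Fin p) (Fin n × Fin p) ℝ}
    {T : Matrix (Fin n × Fin p) (Fin n × Fin p) ℝ} (hS : IsUnit (colStd X T)) (k i : Fin n) :
    X * T ^ (k : ℕ) * (T * Vstd X T i -
        Vstd X T ⟨n - 1, Nat.sub_lt hn one_pos⟩ * X * T ^ n * Vstd X T i) =
      if (k : ℕ) + 1 = i then 1 else 0 := by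
  have hshift : X * T ^ (k : ℕ) * (T * Vstd X T i) = X * T ^ ((k : ℕ) + 1) * Vstd X T i := by
    simp only [pow_succ, Matrix.mul_assoc]
  have hlast : X * T ^ (k : ℕ) *
      (Vstd X T ⟨n - 1, Nat.sub_lt hn one_pos⟩ * X * T ^ n * Vstd X T i) =
      (if k = ⟨n - 1, Nat.sub_lt hn one_pos⟩ then 1 else 0) * (X * T ^ n * Vstd X T i) := by
    rw [← mul_pow_mul_Vstd hS]
    simp only [Matrix.mul_assoc]
  rw [Matrix.mul_sub, hshift, hlast]
  by_cases hk : (k : ℕ) + 1 = n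
  · have hk' : k = ⟨n - 1, Nat.sub_lt hn one_pos⟩ := Fin.ext (by simp only; omega)
    rw [if_pos hk', Matrix.one_mul, hk, sub_self, if_neg i.isLt.ne']
  · have hk' : k ≠ ⟨n - 1, Nat.sub_lt hn one_pos⟩ := fun h => hk (by
      have := congrArg Fin.val h
      simp only at this
      omega)
    have hrow := mul_pow_mul_Vstd hS ⟨(k : ℕ) + 1, by omega⟩ i
    rw [if_neg hk', Matrix.zero_mul, sub_zero, hrow]
    simp only [Fin.ext_iff]

/-- For a pair `(X, T)` with `S = col(X Tˡ)_{l=0}^{n-1}` invertible and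
`S⁻¹ = (V₁ ⋯ Vₙ)`, one has `T V₁ − Vₙ X Tⁿ V₁ = 0` and
`T Vᵢ − Vₙ X Tⁿ Vᵢ = Vᵢ₋₁` for `i = 2, …, n`. -/
theorem standard_pair_inverse_blocks {p n : ℕ} (hn : 0 < n)
    (X : Matrix (Fin p) (Fin n × Fin p) ℝ)
    (T : Matrix (Fin n × Fin p) (Fin n × Fin p) ℝ)
    (hS : IsUnit (colStd X T)) :
    (T * Vstd X T ⟨0, hn⟩ -
        Vstd X T ⟨n - 1, Nat.sub_lt hn one_pos⟩ * X * T ^ n * Vstd X T ⟨0, hn⟩ = 0) ∧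
      ∀ i : Fin n, ∀ h : 0 < (i : ℕ),
        T * Vstd X T i -
            Vstd X T ⟨n - 1, Nat.sub_lt hn one_pos⟩ * X * T ^ n * Vstd X T i =
          Vstd X T ⟨(i : ℕ) - 1, lt_of_le_of_lt (Nat.sub_le _ _) i.isLt⟩ := by
  constructor
  · refine eq_of_colStd_blocks_mul_eq hS fun k => ?_
    rw [mul_pow_mul_shift_Vstd hn hS, if_neg (Nat.succ_ne_zero _), Matrix.mul_zero]
  · intro i h
    refine eq_of_colStd_blocks_mul_eq hS fun k => ?_
    rw [mul_pow_mul_shift_Vstd hn hS, mul_pow_mul_Vstd hS]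
    refine if_congr ?_ rfl rfl
    rw [Fin.ext_iff]
    simp only
    omega
end

section
/- Let x_1,...,x_k be distinct real numbers with positive integers m_1,...,m_k satisfying Σ_{i=1}^k m_i = np, and for each i let v_{i,1},...,v_{i,m_i} ∈ ℝ^p be nonzero linearly independent vectors. Let X be the p×np matrix of these columns, J the np×np diagonal matrix with x_i repeated m_i times (same order), assume col(XJ^l)_{l=0}^{n-1} is invertible, let (V_1 ... V_n) = (col(XJ^l)_{l=0}^{n-1})^{-1} with np×p blocks V_j, let w_{i,j}^T denote the (m_1+...+m_{i-1}+j)-th row of V_n, and let Q̂_n(x) = x^n·I − X·J^n·(V_1 + V_2·x + ... + V_n·x^{n-1}). Then for each i the p×p matrix polynomial M_i(x) = (v_{i,1} ... v_{i,m_i})·(w_{i,1}^T; ...; w_{i,m_i}^T)·Q̂_n(x) is divisible by (x − x_i), and writing W_i(x) = M_i(x)/(x − x_i), for any function F : ℝ → ℝ^{p×p} the matrix polynomial P(x) = Σ_{i=1}^k F(x_i)·W_i(x) has degree at most n−1 and satisfies P(x_i)·v_{i,j} = F(x_i)·v_{i,j} for all j = 1,...,m_i and i = 1,...,k. -/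
open Polynomial Matrix

/-- The monic matrix polynomial `Q̂ₙ(x) = xⁿ I − X Jⁿ (V₁ + V₂ x + ⋯ + Vₙ xⁿ⁻¹)`
associated with the pair `(X, J)`. -/
noncomputable def Qhat {p n k : ℕ} (x : Fin k → ℝ) (m : Fin k → ℕ)
    (v : (i : Fin k) → Fin (m i) → Fin p → ℝ)
    (e : (Fin n × Fin p) ≃ LagIdx k m) :
    Polynomial (Matrix (Fin p) (Fin p) ℝ) :=
  Polynomial.X ^ n -
    ∑ j : Fin n,
      Polynomial.C (Xmat m v * Jmat x m ^ n * Vblock x m v e j) *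
        Polynomial.X ^ (j : ℕ)

/-- The matrix of scalar polynomials
`M_i(x) = (v_{i,1} ⋯ v_{i,m_i}) (w_{i,1}ᵀ; ⋯; w_{i,m_i}ᵀ) Q̂ₙ(x)`, where `w_{i,j}ᵀ` is
the row of the last inverse block `Vₙ` corresponding to the column `v_{i,j}` of `X`. -/
noncomputable def Mpoly {p n k : ℕ} (hn : 0 < n) (x : Fin k → ℝ) (m : Fin k → ℕ)
    (v : (i : Fin k) → Fin (m i) → Fin p → ℝ)
    (e : (Fin n × Fin p) ≃ LagIdx k m) (i : Fin k) :
    Matrix (Fin p) (Fin p) (Polynomial ℝ) :=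
  matPolyEquiv.symm
    (Polynomial.C
        (Matrix.of fun r c : Fin p =>
          ∑ j : Fin (m i),
            v i j r * Vblock x m v e ⟨n - 1, Nat.sub_lt hn one_pos⟩ ⟨i, j⟩ c) *
      Qhat x m v e)

/-- The entrywise quotient `W_i(x) = M_i(x) / (x − x_i)`. -/
noncomputable def Wlag {p n k : ℕ} (hn : 0 < n) (x : Fin k → ℝ) (m : Fin k → ℕ)
    (v : (i : Fin k) → Fin (m i) → Fin p → ℝ)
    (e : (Fin n × Fin p) ≃ LagIdx k m) (i : Fin k) (t : ℝ) :
    Matrix (Fin p) (Fin p) ℝ :=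
  Matrix.of fun r c =>
    ((Mpoly hn x m v e i r c) /ₘ (Polynomial.X - Polynomial.C (x i))).eval t

theorem Xmat_mul_Jmat_pow_mul_Vblock {p n k : ℕ} (x : Fin k → ℝ) (m : Fin k → ℕ)
    (v : (i : Fin k) → Fin (m i) → Fin p → ℝ) (e : (Fin n × Fin p) ≃ LagIdx k m)
    (hinv : IsUnit (colLag x m v e)) (l j : Fin n) :
    Xmat m v * Jmat x m ^ (l : ℕ) * Vblock x m v e j = if l = j then 1 else 0 := by
  have h : colLag x m v e * (colLag x m v e)⁻¹ = 1 :=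
    Matrix.mul_nonsing_inv _ ((Matrix.isUnit_iff_isUnit_det _).1 hinv)
  ext r c
  have h' := congrFun (congrFun h (l, r)) (j, c)
  rw [Matrix.mul_apply] at h' ⊢
  rw [← e.sum_comp]
  simp only [Vblock, Matrix.of_apply, Equiv.symm_apply_apply]
  refine h'.trans ?_
  by_cases hlj : l = j <;> simp [Matrix.one_apply, hlj]

theorem sum_Vblock_mul_Xmat_mul_Jmat_pow {p n k : ℕ} (x : Fin k → ℝ) (m : Fin k → ℕ)
    (v : (i : Fin k) → Fin (m i) → Fin p → ℝ) (e : (Fin n × Fin p) ≃ LagIdx k m)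
    (hinv : IsUnit (colLag x m v e)) :
    ∑ l : Fin n, Vblock x m v e l * (Xmat m v * Jmat x m ^ (l : ℕ)) = 1 := by
  have h : (colLag x m v e)⁻¹ * colLag x m v e = 1 :=
    Matrix.nonsing_inv_mul _ ((Matrix.isUnit_iff_isUnit_det _).1 hinv)
  ext a b
  have h' := congrFun (congrFun h (e.symm a)) (e.symm b)
  rw [Matrix.mul_apply, Fintype.sum_prod_type] at h'
  simp only [colLag, Matrix.of_apply, Equiv.apply_symm_apply, Matrix.one_apply,
    EmbeddingLike.apply_eq_iff_eq] at h'
  rw [Matrix.sum_apply, Matrix.one_apply, ← h']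
  rfl

theorem Jmat_mul_Vblock {p N k : ℕ} (x : Fin k → ℝ) (m : Fin k → ℕ)
    (v : (i : Fin k) → Fin (m i) → Fin p → ℝ) (e : (Fin (N + 1) × Fin p) ≃ LagIdx k m)
    (hinv : IsUnit (colLag x m v e)) (l : Fin (N + 1)) :
    Jmat x m * Vblock x m v e l =
      (∑ j : Fin N, if j.succ = l then Vblock x m v e j.castSucc else 0) +
        Vblock x m v e (Fin.last N) *
          (Xmat m v * Jmat x m ^ (N + 1) * Vblock x m v e l) := by
  have hexp : Jmat x m * Vblock x m v e l =
      (∑ j : Fin (N + 1), Vblock x m v e j * (Xmat m v * Jmat x m ^ (j : ℕ))) *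
        (Jmat x m * Vblock x m v e l) := by
    rw [sum_Vblock_mul_Xmat_mul_Jmat_pow x m v e hinv, Matrix.one_mul]
  have hstep (j : Fin (N + 1)) :
      Vblock x m v e j * (Xmat m v * Jmat x m ^ (j : ℕ)) * (Jmat x m * Vblock x m v e l) =
        Vblock x m v e j * (Xmat m v * Jmat x m ^ ((j : ℕ) + 1) * Vblock x m v e l) := by
    simp only [pow_succ, Matrix.mul_assoc]
  rw [hexp, Matrix.sum_mul, Fin.sum_univ_castSucc]
  simp only [hstep]
  congr 1
  refine Finset.sum_congr rfl fun j _ => ?_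
  have h := Xmat_mul_Jmat_pow_mul_Vblock x m v e hinv j.succ l
  rw [Fin.val_succ] at h
  rw [Fin.val_castSucc, h]
  split_ifs <;> simp

/-- The contribution of the columns of `X` belonging to `x i` to the product of `X` with the
`l`-th block of the inverse. -/
noncomputable def partialBlock {p n k : ℕ} (x : Fin k → ℝ) (m : Fin k → ℕ)
    (v : (i : Fin k) → Fin (m i) → Fin p → ℝ) (e : (Fin n × Fin p) ≃ LagIdx k m)
    (i : Fin k) (l : Fin n) : Matrix (Fin p) (Fin p) ℝ :=
  Matrix.of fun r c => ∑ j : Fin (m i), v i j r * Vblock x m v e l ⟨i, j⟩ c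

theorem partialBlock_eq_mul {p n k : ℕ} (x : Fin k → ℝ) (m : Fin k → ℕ)
    (v : (i : Fin k) → Fin (m i) → Fin p → ℝ) (e : (Fin n × Fin p) ≃ LagIdx k m)
    (i : Fin k) (l : Fin n) :
    partialBlock x m v e i l =
      (Matrix.of fun r j => v i j r : Matrix (Fin p) (Fin (m i)) ℝ) *
        (Vblock x m v e l).submatrix (Sigma.mk i) id := by
  ext r c
  simp [partialBlock, Matrix.mul_apply]

theorem smul_partialBlock {p N k : ℕ} (x : Fin k → ℝ) (m : Fin k → ℕ)
    (v : (i : Fin k) → Fin (m i) → Fin p → ℝ) (e : (Fin (N + 1) × Fin p) ≃ LagIdx k m)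
    (hinv : IsUnit (colLag x m v e)) (i : Fin k) (l : Fin (N + 1)) :
    x i • partialBlock x m v e i l =
      (∑ j : Fin N, if j.succ = l then partialBlock x m v e i j.castSucc else 0) +
        partialBlock x m v e i (Fin.last N) *
          (Xmat m v * Jmat x m ^ (N + 1) * Vblock x m v e l) := by
  have hJ : x i • (Vblock x m v e l).submatrix (Sigma.mk i) id =
      (Jmat x m * Vblock x m v e l).submatrix (Sigma.mk i) id := by
    ext a c
    simp [Jmat, Matrix.diagonal_mul]
  have hsub : (∑ j : Fin N, if j.succ = l then Vblock x m v e j.castSucc else 0).submatrix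
      (Sigma.mk i) id =
      ∑ j : Fin N, if j.succ = l then
        (Vblock x m v e j.castSucc).submatrix (Sigma.mk i) id else 0 := by
    ext a c
    simp only [Matrix.submatrix_apply, Matrix.sum_apply]
    refine Finset.sum_congr rfl fun j _ => ?_
    split_ifs <;> rfl
  simp only [partialBlock_eq_mul]
  rw [← Matrix.mul_smul, hJ, Jmat_mul_Vblock x m v e hinv, Matrix.submatrix_add, Pi.add_apply,
    Pi.add_apply, Matrix.mul_add, hsub, Matrix.mul_sum, Matrix.mul_assoc]
  congr 1
  · refine Finset.sum_congr rfl fun j _ => ?_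
    split_ifs <;> simp
  · rw [Matrix.mul_assoc]
    rfl

/-- The polynomial whose coefficients are the matrices `partialBlock x m v e i l`; it is the
quotient of `M_i` by `X - x i`. -/
noncomputable def partialPoly {p n k : ℕ} (x : Fin k → ℝ) (m : Fin k → ℕ)
    (v : (i : Fin k) → Fin (m i) → Fin p → ℝ) (e : (Fin n × Fin p) ≃ LagIdx k m)
    (i : Fin k) : Polynomial (Matrix (Fin p) (Fin p) ℝ) :=
  ∑ l : Fin n, Polynomial.C (partialBlock x m v e i l) * Polynomial.X ^ (l : ℕ)

theorem C_partialBlock_mul_Qhat {p N k : ℕ} (x : Fin k → ℝ) (m : Fin k → ℕ)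
    (v : (i : Fin k) → Fin (m i) → Fin p → ℝ) (e : (Fin (N + 1) × Fin p) ≃ LagIdx k m)
    (hinv : IsUnit (colLag x m v e)) (i : Fin k) :
    Polynomial.C (partialBlock x m v e i (Fin.last N)) * Qhat x m v e =
      (Polynomial.X - Polynomial.C (Matrix.scalar (Fin p) (x i))) * partialPoly x m v e i := by
  have hrec (l : Fin (N + 1)) :
      Polynomial.C (partialBlock x m v e i (Fin.last N)) *
        (Polynomial.C (Xmat m v * Jmat x m ^ (N + 1) * Vblock x m v e l) *
          Polynomial.X ^ (l : ℕ)) =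
      Polynomial.C (Matrix.scalar (Fin p) (x i)) *
          (Polynomial.C (partialBlock x m v e i l) * Polynomial.X ^ (l : ℕ)) -
        Polynomial.C (∑ j : Fin N,
          if j.succ = l then partialBlock x m v e i j.castSucc else 0) *
            Polynomial.X ^ (l : ℕ) := by
    rw [← mul_assoc, ← mul_assoc, ← Polynomial.C_mul, ← Polynomial.C_mul, ← sub_mul,
      ← Polynomial.C_sub, Matrix.scalar_apply, ← Matrix.smul_eq_diagonal_mul,
      smul_partialBlock x m v e hinv, add_sub_cancel_left]
  have hshift : ∑ l : Fin (N + 1), Polynomial.C (∑ j : Fin N,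
        if j.succ = l then partialBlock x m v e i j.castSucc else 0) *
          (Polynomial.X : Polynomial (Matrix (Fin p) (Fin p) ℝ)) ^ (l : ℕ) =
      ∑ j : Fin N, Polynomial.C (partialBlock x m v e i j.castSucc) *
        Polynomial.X ^ ((j : ℕ) + 1) := by
    rw [Fin.sum_univ_succ]
    simp [Fin.succ_ne_zero]
  rw [Qhat, mul_sub, Finset.mul_sum, Finset.sum_congr rfl fun l _ => hrec l,
    Finset.sum_sub_distrib, hshift, partialPoly, sub_mul, ← Finset.mul_sum,
    Polynomial.X_mul, Finset.sum_mul (s := Finset.univ) (a := Polynomial.X),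
    Fin.sum_univ_castSucc (fun l : Fin (N + 1) => _ * Polynomial.X ^ (l : ℕ) * Polynomial.X)]
  simp only [mul_assoc, ← pow_succ, Fin.val_castSucc, Fin.val_last]
  abel

theorem Mpoly_apply {p n k : ℕ} (hn : 0 < n) (x : Fin k → ℝ) (m : Fin k → ℕ)
    (v : (i : Fin k) → Fin (m i) → Fin p → ℝ) (e : (Fin n × Fin p) ≃ LagIdx k m)
    (hinv : IsUnit (colLag x m v e)) (i : Fin k) (r c : Fin p) :
    Mpoly hn x m v e i r c =
      (Polynomial.X - Polynomial.C (x i)) * matPolyEquiv.symm (partialPoly x m v e i) r c := by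
  obtain ⟨N, rfl⟩ := Nat.exists_eq_succ_of_ne_zero hn.ne'
  have hlin : matPolyEquiv.symm
      (Polynomial.X - Polynomial.C (Matrix.scalar (Fin p) (x i))) =
      Matrix.diagonal fun _ => (Polynomial.X - Polynomial.C (x i) : Polynomial ℝ) := by
    rw [map_sub, matPolyEquiv_symm_X, matPolyEquiv_symm_C, Matrix.scalar_apply,
      Matrix.diagonal_map (map_zero _), ← Matrix.diagonal_sub]
  have h := congrArg matPolyEquiv.symm (C_partialBlock_mul_Qhat x m v e hinv i)
  rw [map_mul matPolyEquiv.symm (Polynomial.X - _), hlin] at h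
  have h' := congrFun (congrFun h r) c
  rwa [Matrix.diagonal_mul] at h'

theorem Wlag_eq_mev {p n k : ℕ} (hn : 0 < n) (x : Fin k → ℝ) (m : Fin k → ℕ)
    (v : (i : Fin k) → Fin (m i) → Fin p → ℝ) (e : (Fin n × Fin p) ≃ LagIdx k m)
    (hinv : IsUnit (colLag x m v e)) (i : Fin k) (t : ℝ) :
    Wlag hn x m v e i t = mev (partialPoly x m v e i) t := by
  ext r c
  rw [Wlag, Matrix.of_apply, Mpoly_apply hn x m v e hinv,
    Polynomial.mul_divByMonic_cancel_left _ (Polynomial.monic_X_sub_C _), ← matPolyEquiv_eval,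
    AlgEquiv.apply_symm_apply, mev, Matrix.scalar_apply, Matrix.smul_one_eq_diagonal]

theorem mev_partialPoly {p n k : ℕ} (x : Fin k → ℝ) (m : Fin k → ℕ)
    (v : (i : Fin k) → Fin (m i) → Fin p → ℝ) (e : (Fin n × Fin p) ≃ LagIdx k m)
    (i : Fin k) (t : ℝ) :
    mev (partialPoly x m v e i) t = ∑ l : Fin n, t ^ (l : ℕ) • partialBlock x m v e i l := by
  simp [mev, partialPoly, Polynomial.eval_finsetSum, _root_.smul_pow]

theorem mev_partialPoly_mulVec {p n k : ℕ} (x : Fin k → ℝ) (m : Fin k → ℕ)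
    (v : (i : Fin k) → Fin (m i) → Fin p → ℝ) (e : (Fin n × Fin p) ≃ LagIdx k m)
    (hinv : IsUnit (colLag x m v e)) (i' i : Fin k) (j : Fin (m i)) :
    mev (partialPoly x m v e i') (x i) *ᵥ v i j = if i' = i then v i j else 0 := by
  have hXJ (l : ℕ) (c : Fin p) :
      (Xmat m v * Jmat x m ^ l) c ⟨i, j⟩ = x i ^ l * v i j c := by
    rw [Jmat, Matrix.diagonal_pow, Matrix.mul_diagonal]
    simp [Xmat, mul_comm]
  have hdual (j' : Fin (m i')) :
      ∑ l : Fin n, ∑ c, Vblock x m v e l ⟨i', j'⟩ c * (x i ^ (l : ℕ) * v i j c) =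
        (1 : Matrix (LagIdx k m) (LagIdx k m) ℝ) ⟨i', j'⟩ ⟨i, j⟩ := by
    rw [← sum_Vblock_mul_Xmat_mul_Jmat_pow x m v e hinv, Matrix.sum_apply]
    simp only [Matrix.mul_apply (M := Vblock x m v e _), hXJ]
  have hexp (r : Fin p) : (mev (partialPoly x m v e i') (x i) *ᵥ v i j) r =
      ∑ j', v i' j' r * (1 : Matrix (LagIdx k m) (LagIdx k m) ℝ) ⟨i', j'⟩ ⟨i, j⟩ := by
    simp only [← hdual, mev_partialPoly, Matrix.mulVec, dotProduct, Matrix.sum_apply,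
      Matrix.smul_apply, partialBlock, Matrix.of_apply, smul_eq_mul, Finset.mul_sum,
      Finset.sum_mul]
    rw [Finset.sum_comm' (t' := Finset.univ) (s' := fun _ => Finset.univ) (by simp)]
    rw [Finset.sum_comm (s := (Finset.univ : Finset (Fin (m i'))))]
    refine Finset.sum_congr rfl fun l _ => ?_
    rw [Finset.sum_comm (s := (Finset.univ : Finset (Fin (m i'))))]
    refine Finset.sum_congr rfl fun c _ => Finset.sum_congr rfl fun j' _ => ?_
    ring
  ext r
  rw [hexp]
  by_cases h : i' = i
  · subst h
    simp [Matrix.one_apply]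
  · simp [h]

/-- Lagrange interpolation via the rows of `Vₙ` (left rootvectors of `Q̂ₙ`): each
`M_i(x)` is divisible by `x − x_i`, and with `W_i(x) = M_i(x)/(x − x_i)`, for any
`F : ℝ → ℝ^{p×p}` the matrix polynomial `P(x) = ∑_i F(x_i) W_i(x)` has degree at most
`n − 1` and satisfies `P(x_i) v_{i,j} = F(x_i) v_{i,j}`. -/
theorem lagrange_interpolation_rootvectors {p n k : ℕ} (hn : 0 < n)
    (x : Fin k → ℝ) (hx : Function.Injective x)
    (m : Fin k → ℕ) (hm : ∀ i, 0 < m i) (hsum : (∑ i, m i) = n * p)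
    (v : (i : Fin k) → Fin (m i) → Fin p → ℝ)
    (hv0 : ∀ i j, v i j ≠ 0) (hv : ∀ i, LinearIndependent ℝ (v i))
    (e : (Fin n × Fin p) ≃ LagIdx k m)
    (hinv : IsUnit (colLag x m v e (n := n))) :
    (∀ (i : Fin k) (r c : Fin p),
        (Polynomial.X - Polynomial.C (x i)) ∣ Mpoly hn x m v e i r c) ∧
      ∀ F : ℝ → Matrix (Fin p) (Fin p) ℝ,
        (∃ Q : Polynomial (Matrix (Fin p) (Fin p) ℝ), Q.degree < (n : ℕ) ∧
            ∀ t : ℝ, mev Q t = ∑ i, F (x i) * Wlag hn x m v e i t) ∧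
          ∀ (i : Fin k) (j : Fin (m i)),
            (∑ i', F (x i') * Wlag hn x m v e i' (x i)) *ᵥ v i j =
              F (x i) *ᵥ v i j := by
  refine ⟨fun i r c => ⟨_, Mpoly_apply hn x m v e hinv i r c⟩, fun F => ⟨?_, fun i j => ?_⟩⟩
  · refine ⟨∑ l : Fin n, Polynomial.C (∑ i, F (x i) * partialBlock x m v e i l) *
      Polynomial.X ^ (l : ℕ), Polynomial.degree_sum_fin_lt _, fun t => ?_⟩
    simp only [Wlag_eq_mev hn x m v e hinv, mev_partialPoly, Finset.mul_sum]
    rw [Finset.sum_comm]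
    simp [mev, Polynomial.eval_finsetSum, _root_.smul_pow, Finset.smul_sum]
  · simp only [Matrix.sum_mulVec, ← Matrix.mulVec_mulVec, Wlag_eq_mev hn x m v e hinv,
      mev_partialPoly_mulVec x m v e hinv]
    rw [Finset.sum_eq_single i (fun i' _ h => by simp [h]) (by simp), if_pos rfl]
end

section
/- Let W be a weight matrix function on a finite interval [a,b] and let (P_n)_{n≥0} be a sequence of orthonormal matrix polynomials with respect to W, satisfying the three-term recurrence with symmetric positive definite matrices D_n. If v ∈ ℝ^p is a rootvector of P_n corresponding to a zero x_0 (i.e., v ≠ 0 and P_n(x_0)·v = 0), then for all real x: v^T·P_{n+1}(x_0)^T·D_{n+1}·P_n(x) = −(x − x_0)·v^T·(Σ_{l=0}^{n-1} P_l(x_0)^T·P_l(x)). -/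
open Polynomial Matrix MeasureTheory

/-- The **Christoffel–Darboux identity** for two matrix sequences solving the same symmetric
three-term recurrence with spectral parameters `y` and `x`. -/
theorem christoffelDarboux_of_recurrence {m R : Type*} [Fintype m] [CommRing R]
    {A B D E : ℕ → Matrix m m R} {x y : R}
    (hD : ∀ n, (D n).IsSymm) (hE : ∀ n, (E n).IsSymm)
    (hA₀ : y • A 0 = D 1 * A 1 + E 0 * A 0)
    (hA : ∀ n, y • A (n + 1) = D (n + 2) * A (n + 2) + E (n + 1) * A (n + 1) + D (n + 1) * A n)
    (hB₀ : x • B 0 = D 1 * B 1 + E 0 * B 0)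
    (hB : ∀ n, x • B (n + 1) = D (n + 2) * B (n + 2) + E (n + 1) * B (n + 1) + D (n + 1) * B n)
    (n : ℕ) :
    (x - y) • ∑ l ∈ Finset.range (n + 1), (A l)ᵀ * B l =
      (A n)ᵀ * D (n + 1) * B (n + 1) - (A (n + 1))ᵀ * D (n + 1) * B n := by
  have key (l : ℕ) : (x - y) • ((A l)ᵀ * B l) = (A l)ᵀ * (x • B l) - (y • A l)ᵀ * B l := by
    rw [sub_smul, transpose_smul, Matrix.mul_smul, Matrix.smul_mul]
  induction n with
  | zero =>
    rw [Finset.sum_range_one, key, hA₀, hB₀]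
    simp only [transpose_add, transpose_mul, (hD _).eq, (hE _).eq, Matrix.mul_add,
      Matrix.add_mul, Matrix.mul_assoc]
    abel
  | succ n ih =>
    rw [Finset.sum_range_succ, smul_add, ih, key, hA, hB]
    simp only [transpose_add, transpose_mul, (hD _).eq, (hE _).eq, Matrix.mul_add,
      Matrix.add_mul, Matrix.mul_assoc]
    abel

/-- If `v` is a rootvector of the orthonormal matrix polynomial `Pₙ` corresponding to
the zero `x₀` (i.e. `v ≠ 0` and `Pₙ(x₀) v = 0`), then for all `x`,
`vᵀ Pₙ₊₁(x₀)ᵀ Dₙ₊₁ Pₙ(x) = −(x − x₀) vᵀ (∑_{l=0}^{n-1} P_l(x₀)ᵀ P_l(x))`.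
Here `(Pₙ)` satisfies the three-term recurrence
`x Pₙ(x) = Dₙ₊₁ Pₙ₊₁(x) + Eₙ Pₙ(x) + Dₙ Pₙ₋₁(x)` (with `P₋₁ = 0`), the `Dₙ`
symmetric positive definite and the `Eₙ` symmetric. -/
theorem rootvector_christoffel_darboux {p : ℕ} (a b : ℝ)
    (W : ℝ → Matrix (Fin p) (Fin p) ℝ) (hW : IsWeight p a b W)
    (P : ℕ → Polynomial (Matrix (Fin p) (Fin p) ℝ))
    (hP : IsOrthonormal p a b W P)
    (D E : ℕ → Matrix (Fin p) (Fin p) ℝ)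
    (hD : ∀ n, (D n).PosDef) (hE : ∀ n, (E n).IsSymm)
    (hrec0 : ∀ x : ℝ, x • mev (P 0) x = D 1 * mev (P 1) x + E 0 * mev (P 0) x)
    (hrec : ∀ (n : ℕ) (x : ℝ),
      x • mev (P (n + 1)) x =
        D (n + 2) * mev (P (n + 2)) x + E (n + 1) * mev (P (n + 1)) x +
          D (n + 1) * mev (P n) x)
    (n : ℕ) (x₀ : ℝ) (v : Fin p → ℝ) (hv : v ≠ 0)
    (hker : mev (P n) x₀ *ᵥ v = 0) :
    ∀ x : ℝ,
      v ᵥ* ((mev (P (n + 1)) x₀)ᵀ * D (n + 1) * mev (P n) x) =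
        -((x - x₀) •
          (v ᵥ* ∑ l ∈ Finset.range n, (mev (P l) x₀)ᵀ * mev (P l) x)) := by
  intro x
  have hDs (k : ℕ) : (D k).IsSymm := by simpa using (hD k).isHermitian
  have hv₀ : v ᵥ* (mev (P n) x₀)ᵀ = 0 := by rw [vecMul_transpose, hker]
  have h := congrArg (v ᵥ* ·) (christoffelDarboux_of_recurrence (A := fun k => mev (P k) x₀)
    (B := fun k => mev (P k) x) hDs hE (hrec0 x₀) (hrec · x₀) (hrec0 x) (hrec · x) n)
  simp only [Finset.sum_range_succ, vecMul_smul, vecMul_add, vecMul_sub, ← vecMul_vecMul, hv₀,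
    zero_vecMul, add_zero, zero_sub] at h
  rw [h, neg_neg]
  simp only [vecMul_vecMul, Matrix.mul_assoc]
end

section
/- Let W be a weight matrix function on a finite interval [a,b], (P_n)_{n≥0} a sequence of orthonormal matrix polynomials with respect to W, and n ≥ 1. Let x_1,...,x_k be the distinct zeros of P_n (roots of det P_n), with multiplicities m_1,...,m_k satisfying Σ_{i=1}^k m_i = np, and for each i let v_{i,1},...,v_{i,m_i} ∈ ℝ^p be linearly independent vectors with P_n(x_i)·v_{i,j} = 0; assume col(XJ^l)_{l=0}^{n-1} is invertible, where X is the p×np matrix with columns v_{i,j} and J is the np×np diagonal matrix with x_i repeated m_i times. For each i define the m_i×m_i matrix L_i with entries (L_i)_{s,t} = v_{i,s}^T·K_{n-1}(x_i,x_i)·v_{i,t} (which is invertible), where K_{n-1}(x,y) = Σ_{l=0}^{n-1} P_l(y)^T·P_l(x), and define W_i(x) = (v_{i,1} ... v_{i,m_i})·L_i^{-1}·(v_{i,1}^T; ...; v_{i,m_i}^T)·(Σ_{l=0}^{n-1} P_l(x_i)^T·P_l(x)). Then each W_i is a matrix polynomial of degree at most n−1 satisfying W_i(x_l)·v_{l,j}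 = v_{i,j} if l = i and W_i(x_l)·v_{l,j} = 0 if l ≠ i; consequently, for any F : ℝ → ℝ^{p×p}, the polynomial P(x) = Σ_{i=1}^k F(x_i)·W_i(x) satisfies P(x_i)·v_{i,j} = F(x_i)·v_{i,j} for all i, j. -/
open Polynomial Matrix MeasureTheory

/-- The kernel `K_{n-1}(t, y) = ∑_{l=0}^{n-1} P_l(y)ᵀ P_l(t)`. -/
noncomputable def Kker {p : ℕ} (P : ℕ → Polynomial (Matrix (Fin p) (Fin p) ℝ))
    (n : ℕ) (y t : ℝ) : Matrix (Fin p) (Fin p) ℝ :=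
  ∑ l ∈ Finset.range n, (mev (P l) y)ᵀ * mev (P l) t

/-- The `p × m_i` matrix `(v_{i,1} ⋯ v_{i,m_i})`. -/
def Vmat {p k : ℕ} (m : Fin k → ℕ) (v : (i : Fin k) → Fin (m i) → Fin p → ℝ)
    (i : Fin k) : Matrix (Fin p) (Fin (m i)) ℝ :=
  Matrix.of fun r j => v i j r

/-- The `m_i × m_i` matrix `L_i` with entries `(L_i)_{s,t} = v_{i,s}ᵀ K_{n-1}(x_i, x_i) v_{i,t}`. -/
noncomputable def Lmat {p k : ℕ} (P : ℕ → Polynomial (Matrix (Fin p) (Fin p) ℝ))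
    (n : ℕ) (x : Fin k → ℝ) (m : Fin k → ℕ)
    (v : (i : Fin k) → Fin (m i) → Fin p → ℝ) (i : Fin k) :
    Matrix (Fin (m i)) (Fin (m i)) ℝ :=
  Matrix.of fun s t => v i s ⬝ᵥ (Kker P n (x i) (x i) *ᵥ v i t)

/-- The Gaussian quadrature coefficient
`Λ_i = (v_{i,1} ⋯ v_{i,m_i}) L_i⁻¹ (v_{i,1}ᵀ; ⋯; v_{i,m_i}ᵀ)`. -/
noncomputable def Lam {p k : ℕ} (P : ℕ → Polynomial (Matrix (Fin p) (Fin p) ℝ))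
    (n : ℕ) (x : Fin k → ℝ) (m : Fin k → ℕ)
    (v : (i : Fin k) → Fin (m i) → Fin p → ℝ) (i : Fin k) :
    Matrix (Fin p) (Fin p) ℝ :=
  Vmat m v i * (Lmat P n x m v i)⁻¹ * (Vmat m v i)ᵀ

/-- Evaluation of a matrix polynomial is continuous in the real variable. -/
lemma continuous_mev {p : ℕ} (Q : Polynomial (Matrix (Fin p) (Fin p) ℝ)) :
    Continuous (mev Q) := by
  have h : Continuous fun t : ℝ => t • (1 : Matrix (Fin p) (Fin p) ℝ) := by fun_prop
  exact Q.continuous.comp h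

lemma mev_sum_C_mul {p : ℕ} (P : ℕ → Polynomial (Matrix (Fin p) (Fin p) ℝ))
    (A : ℕ → Matrix (Fin p) (Fin p) ℝ) (N : ℕ) (t : ℝ) :
    mev (∑ l ∈ Finset.range N, C (A l) * P l) t =
      ∑ l ∈ Finset.range N, A l * mev (P l) t := by
  simp [mev, eval_finsetSum, eval_C_mul]

lemma mev_mul_X {p : ℕ} (Q : Polynomial (Matrix (Fin p) (Fin p) ℝ)) (t : ℝ) :
    mev (Q * X) t = t • mev Q t := by
  simp [mev]

/-- A sequence of matrix polynomials with `deg Pₙ = n` and invertible leading coefficients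
spans, with matrix coefficients, all matrix polynomials. -/
lemma exists_eq_sum_C_mul {R : Type*} [Ring R] (P : ℕ → Polynomial R)
    (hdeg : ∀ n, (P n).natDegree = n) (hlead : ∀ n, IsUnit (P n).leadingCoeff)
    (N : ℕ) (Q : Polynomial R) (hQ : Q.degree < (N : ℕ)) :
    ∃ A : ℕ → R, Q = ∑ l ∈ Finset.range N, C (A l) * P l := by
  induction N generalizing Q with
  | zero =>
    refine ⟨0, ?_⟩
    ext m
    simpa using (degree_lt_iff_coeff_zero Q 0).1 hQ m (Nat.zero_le _)
  | succ N ih =>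
    obtain ⟨u, hu⟩ := hlead N
    set c : R := Q.coeff N * ↑u⁻¹ with hc
    have hsub : (Q - C c * P N).degree < (N : ℕ) := by
      rw [degree_lt_iff_coeff_zero]
      intro r hr
      rw [coeff_sub, coeff_C_mul]
      rcases hr.eq_or_lt with rfl | hlt
      · have : (P N).coeff N = u := by
          rw [hu, leadingCoeff, hdeg]
        rw [this, hc, mul_assoc, Units.inv_mul, mul_one, sub_self]
      · rw [(degree_lt_iff_coeff_zero Q (N + 1)).1 hQ r hlt,
          coeff_eq_zero_of_natDegree_lt (by rw [hdeg]; exact hlt), mul_zero, sub_zero]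
    obtain ⟨A, hA⟩ := ih _ hsub
    refine ⟨Function.update A N c, ?_⟩
    rw [Finset.sum_range_succ, Function.update_self]
    have : ∑ l ∈ Finset.range N, C (Function.update A N c l) * P l =
        ∑ l ∈ Finset.range N, C (A l) * P l := by
      refine Finset.sum_congr rfl fun l hl => ?_
      rw [Function.update_of_ne (Finset.mem_range.1 hl).ne]
    rw [this, ← hA, sub_add_cancel]

lemma mInt_sum {p : ℕ} {a b : ℝ} {ι : Type*} (s : Finset ι)
    (F : ι → ℝ → Matrix (Fin p) (Fin p) ℝ)
    (hF : ∀ l ∈ s, ∀ i j, IntervalIntegrable (fun t => F l t i j) volume a b) :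
    mInt a b (fun t => ∑ l ∈ s, F l t) = ∑ l ∈ s, mInt a b (F l) := by
  ext i j
  simp only [mInt, Matrix.of_apply, Matrix.sum_apply]
  exact intervalIntegral.integral_finsetSum fun l hl => hF l hl i j

lemma mInt_const_mul {p : ℕ} {a b : ℝ} (A : Matrix (Fin p) (Fin p) ℝ)
    (F : ℝ → Matrix (Fin p) (Fin p) ℝ)
    (hF : ∀ i j, IntervalIntegrable (fun t => F t i j) volume a b) :
    mInt a b (fun t => A * F t) = A * mInt a b F := by
  ext i j
  simp only [mInt, Matrix.of_apply, Matrix.mul_apply]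
  rw [intervalIntegral.integral_finsetSum fun l _ => (hF l j).const_mul _]
  simp

lemma mInt_mul_const {p : ℕ} {a b : ℝ} (A : Matrix (Fin p) (Fin p) ℝ)
    (F : ℝ → Matrix (Fin p) (Fin p) ℝ)
    (hF : ∀ i j, IntervalIntegrable (fun t => F t i j) volume a b) :
    mInt a b (fun t => F t * A) = mInt a b F * A := by
  ext i j
  simp only [mInt, Matrix.of_apply, Matrix.mul_apply]
  rw [intervalIntegral.integral_finsetSum fun l _ => (hF i l).mul_const _]
  simp

lemma intervalIntegrable_matrix_mul_left {p : ℕ} {a b : ℝ}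
    (F G : ℝ → Matrix (Fin p) (Fin p) ℝ) (hF : Continuous F)
    (hG : ∀ i j, IntervalIntegrable (fun t => G t i j) volume a b) (i j : Fin p) :
    IntervalIntegrable (fun t => (F t * G t) i j) volume a b := by
  simp only [Matrix.mul_apply]
  have h := IntervalIntegrable.sum (μ := volume) (a := a) (b := b) Finset.univ
    (f := fun l t => F t i l * G t l j)
    fun l _ => (hG l j).continuousOn_mul (hF.matrix_elem i l).continuousOn
  simpa [Finset.sum_fn] using h

lemma intervalIntegrable_matrix_mul_right {p : ℕ} {a b : ℝ}
    (F G : ℝ → Matrix (Fin p) (Fin p) ℝ) (hG : Continuous G)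
    (hF : ∀ i j, IntervalIntegrable (fun t => F t i j) volume a b) (i j : Fin p) :
    IntervalIntegrable (fun t => (F t * G t) i j) volume a b := by
  simp only [Matrix.mul_apply]
  have h := IntervalIntegrable.sum (μ := volume) (a := a) (b := b) Finset.univ
    (f := fun l t => F t i l * G t l j)
    fun l _ => (hF i l).mul_continuousOn (hG.matrix_elem l j).continuousOn
  simpa [Finset.sum_fn] using h

lemma IsWeight.intervalIntegrable_mev {p : ℕ} {a b : ℝ}
    {W : ℝ → Matrix (Fin p) (Fin p) ℝ} (hW : IsWeight p a b W)
    (Q R : Polynomial (Matrix (Fin p) (Fin p) ℝ)) (i j : Fin p) :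
    IntervalIntegrable (fun t => (mev Q t * W t * (mev R t)ᵀ) i j) volume a b :=
  intervalIntegrable_matrix_mul_right _ _ (continuous_mev R).matrix_transpose
    (intervalIntegrable_matrix_mul_left _ _ (continuous_mev Q) hW.2.2.1) i j

/-- Coefficients in an orthonormal expansion are recovered by integrating on the left. -/
lemma IsOrthonormal.mInt_left {p : ℕ} {a b : ℝ} {W : ℝ → Matrix (Fin p) (Fin p) ℝ}
    (hW : IsWeight p a b W) {P : ℕ → Polynomial (Matrix (Fin p) (Fin p) ℝ)}
    (hP : IsOrthonormal p a b W P) {N l : ℕ} (hl : l < N)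
    (A : ℕ → Matrix (Fin p) (Fin p) ℝ) :
    mInt a b (fun t => mev (∑ r ∈ Finset.range N, C (A r) * P r) t * W t * (mev (P l) t)ᵀ) =
      A l := by
  simp only [mev_sum_C_mul, Finset.sum_mul, Matrix.mul_assoc]
  simp only [← Matrix.mul_assoc (mev _ _)]
  rw [mInt_sum _ _ fun r _ => intervalIntegrable_matrix_mul_left _ _ continuous_const
    (hW.intervalIntegrable_mev _ _)]
  rw [Finset.sum_congr rfl fun r _ => mInt_const_mul _ _ (hW.intervalIntegrable_mev _ _)]
  simp [hP.2.2.2, hl]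

/-- Coefficients in an orthonormal expansion are recovered by integrating on the right. -/
lemma IsOrthonormal.mInt_right {p : ℕ} {a b : ℝ} {W : ℝ → Matrix (Fin p) (Fin p) ℝ}
    (hW : IsWeight p a b W) {P : ℕ → Polynomial (Matrix (Fin p) (Fin p) ℝ)}
    (hP : IsOrthonormal p a b W P) {N l : ℕ} (hl : l < N)
    (A : ℕ → Matrix (Fin p) (Fin p) ℝ) :
    mInt a b (fun t => mev (P l) t * W t * (mev (∑ r ∈ Finset.range N, C (A r) * P r) t)ᵀ) =
      (A l)ᵀ := by
  simp only [mev_sum_C_mul, Matrix.transpose_sum, Finset.mul_sum, Matrix.transpose_mul,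
    ← Matrix.mul_assoc]
  rw [mInt_sum _ _ fun r _ => intervalIntegrable_matrix_mul_right _ _ continuous_const
    (hW.intervalIntegrable_mev _ _)]
  rw [Finset.sum_congr rfl fun r _ => mInt_mul_const _ _ (hW.intervalIntegrable_mev _ _)]
  simp [hP.2.2.2, hl]

/-- Multiplication by the variable acts on the orthonormal polynomials of degree less than `n`,
modulo `Pₙ`, through a symmetric block matrix (the truncated block Jacobi matrix). -/
lemma IsOrthonormal.exists_jacobi {p : ℕ} {a b : ℝ} {W : ℝ → Matrix (Fin p) (Fin p) ℝ}
    (hW : IsWeight p a b W) {P : ℕ → Polynomial (Matrix (Fin p) (Fin p) ℝ)}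
    (hP : IsOrthonormal p a b W P) (n : ℕ) :
    ∃ A : ℕ → ℕ → Matrix (Fin p) (Fin p) ℝ,
      (∀ r < n, ∀ l < n, A r l = (A l r)ᵀ) ∧
      ∀ r < n, ∀ t, t • mev (P r) t = ∑ l ∈ Finset.range (n + 1), A r l * mev (P l) t := by
  have hex : ∀ r, ∃ A : ℕ → Matrix (Fin p) (Fin p) ℝ,
      r < n → P r * X = ∑ l ∈ Finset.range (n + 1), C (A l) * P l := by
    intro r
    by_cases hr : r < n
    · have hdeg : (P r * X).degree < ((n + 1 : ℕ) : WithBot ℕ) := by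
        rw [degree_lt_iff_coeff_zero]
        intro q hq
        obtain ⟨q, rfl⟩ : ∃ q', q = q' + 1 := ⟨q - 1, by omega⟩
        rw [coeff_mul_X]
        exact coeff_eq_zero_of_natDegree_lt (by rw [hP.1]; omega)
      obtain ⟨A, hA⟩ := exists_eq_sum_C_mul P hP.1 hP.2.1 _ _ hdeg
      exact ⟨A, fun _ => hA⟩
    · exact ⟨0, fun h => absurd h hr⟩
  choose A hA using hex
  refine ⟨A, fun r hr l hl => ?_, fun r hr t => ?_⟩
  · rw [← hP.mInt_left hW (N := n + 1) (by omega) (A r),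
      ← hP.mInt_right hW (N := n + 1) (by omega) (A l), ← hA r hr, ← hA l hl]
    simp [mev_mul_X]
  · rw [← mev_mul_X, hA r hr, mev_sum_C_mul]

lemma dotProduct_Kker_mulVec {p : ℕ} (P : ℕ → Polynomial (Matrix (Fin p) (Fin p) ℝ))
    (n : ℕ) (y t : ℝ) (u w : Fin p → ℝ) :
    u ⬝ᵥ (Kker P n y t *ᵥ w) =
      ∑ l ∈ Finset.range n, (mev (P l) y *ᵥ u) ⬝ᵥ (mev (P l) t *ᵥ w) := by
  rw [Kker, Matrix.sum_mulVec, dotProduct_sum]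
  refine Finset.sum_congr rfl fun l _ => ?_
  rw [← Matrix.mulVec_mulVec, Matrix.dotProduct_mulVec, Matrix.vecMul_transpose]

/-- Root vectors of `Pₙ` at distinct zeros are orthogonal with respect to the kernel. -/
lemma IsOrthonormal.dotProduct_Kker_eq_zero {p : ℕ} {a b : ℝ}
    {W : ℝ → Matrix (Fin p) (Fin p) ℝ}
    (hW : IsWeight p a b W) {P : ℕ → Polynomial (Matrix (Fin p) (Fin p) ℝ)}
    (hP : IsOrthonormal p a b W P) {n : ℕ} {y t : ℝ} (hyt : y ≠ t) {u w : Fin p → ℝ}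
    (hu : mev (P n) y *ᵥ u = 0) (hw : mev (P n) t *ᵥ w = 0) :
    u ⬝ᵥ (Kker P n y t *ᵥ w) = 0 := by
  obtain ⟨A, hsymm, hrec⟩ := hP.exists_jacobi hW n
  have hrec' : ∀ (z : ℝ) (c : Fin p → ℝ), mev (P n) z *ᵥ c = 0 → ∀ r < n,
      z • (mev (P r) z *ᵥ c) = ∑ l ∈ Finset.range n, A r l *ᵥ (mev (P l) z *ᵥ c) := by
    intro z c hc r hr
    rw [← Matrix.smul_mulVec, hrec r hr, Matrix.sum_mulVec, Finset.sum_range_succ]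
    simp only [← Matrix.mulVec_mulVec, hc, Matrix.mulVec_zero, add_zero]
  rw [dotProduct_Kker_mulVec]
  set S := ∑ l ∈ Finset.range n, (mev (P l) y *ᵥ u) ⬝ᵥ (mev (P l) t *ᵥ w) with hS
  have hy : y * S = ∑ r ∈ Finset.range n, ∑ l ∈ Finset.range n,
      (A r l *ᵥ (mev (P l) y *ᵥ u)) ⬝ᵥ (mev (P r) t *ᵥ w) := by
    rw [hS, Finset.mul_sum]
    refine Finset.sum_congr rfl fun r hr => ?_
    rw [← smul_eq_mul, ← smul_dotProduct, hrec' y u hu r (Finset.mem_range.1 hr),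
      sum_dotProduct]
  have ht : t * S = ∑ r ∈ Finset.range n, ∑ l ∈ Finset.range n,
      (mev (P r) y *ᵥ u) ⬝ᵥ (A r l *ᵥ (mev (P l) t *ᵥ w)) := by
    rw [hS, Finset.mul_sum]
    refine Finset.sum_congr rfl fun r hr => ?_
    rw [← smul_eq_mul, ← dotProduct_smul, hrec' t w hw r (Finset.mem_range.1 hr),
      dotProduct_sum]
  have hEq : y * S = t * S := by
    rw [hy, ht, Finset.sum_comm]
    refine Finset.sum_congr rfl fun l hl => Finset.sum_congr rfl fun r hr => ?_
    rw [hsymm l (Finset.mem_range.1 hl) r (Finset.mem_range.1 hr),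
      Matrix.dotProduct_mulVec (mev (P l) y *ᵥ u), Matrix.vecMul_transpose]
  by_contra hne
  exact hyt (mul_right_cancel₀ hne hEq)

lemma Lmat_eq {p k : ℕ} (P : ℕ → Polynomial (Matrix (Fin p) (Fin p) ℝ))
    (n : ℕ) (x : Fin k → ℝ) (m : Fin k → ℕ)
    (v : (i : Fin k) → Fin (m i) → Fin p → ℝ) (i : Fin k) :
    Lmat P n x m v i = (Vmat m v i)ᵀ * (Kker P n (x i) (x i) * Vmat m v i) :=
  rfl

lemma Vmat_mulVec_single {p k : ℕ} (m : Fin k → ℕ)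
    (v : (i : Fin k) → Fin (m i) → Fin p → ℝ) (i : Fin k) (j : Fin (m i)) :
    Vmat m v i *ᵥ Pi.single j 1 = v i j := by
  ext r
  simp [Vmat]

lemma isUnit_Lmat {p k : ℕ} (P : ℕ → Polynomial (Matrix (Fin p) (Fin p) ℝ)) (hP : P 0 = 1)
    {n : ℕ} (hn : 1 ≤ n) (x : Fin k → ℝ) (m : Fin k → ℕ)
    (v : (i : Fin k) → Fin (m i) → Fin p → ℝ) (i : Fin k)
    (hv : LinearIndependent ℝ (v i)) :
    IsUnit (Lmat P n x m v i) := by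
  have hVinj : Function.Injective (Vmat m v i).mulVec := Matrix.mulVec_injective_iff.2 hv
  rw [← Matrix.mulVec_injective_iff_isUnit]
  refine (injective_iff_map_eq_zero (Lmat P n x m v i).mulVecLin).2 fun w hw => ?_
  rw [Matrix.mulVecLin_apply, Lmat_eq] at hw
  apply hVinj
  rw [Matrix.mulVec_zero]
  have hquad : (Vmat m v i *ᵥ w) ⬝ᵥ (Kker P n (x i) (x i) *ᵥ (Vmat m v i *ᵥ w)) = 0 := by
    rw [← Matrix.vecMul_transpose, ← Matrix.dotProduct_mulVec, Matrix.vecMul_transpose,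
      Matrix.mulVec_mulVec, Matrix.mulVec_mulVec, Matrix.mul_assoc, hw, dotProduct_zero]
  rw [dotProduct_Kker_mulVec, Finset.sum_eq_zero_iff_of_nonneg] at hquad
  · have h0 := hquad 0 (Finset.mem_range.2 hn)
    rw [dotProduct_self_eq_zero] at h0
    simpa [mev, hP] using h0
  · intro l _
    exact Finset.sum_nonneg fun r _ => mul_self_nonneg _

/-- Lagrange interpolation at the zeros and rootvectors of the orthonormal matrix
polynomial `Pₙ`: with `L_i` invertible,
`W_i(x) = (v_{i,1} ⋯ v_{i,m_i}) L_i⁻¹ (v_{i,1}ᵀ; ⋯; v_{i,m_i}ᵀ) K_{n-1}(x, x_i)` is a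
matrix polynomial of degree at most `n − 1` with `W_i(x_l) v_{l,j} = δ_{il} v_{i,j}`,
and `P(x) = ∑_i F(x_i) W_i(x)` interpolates: `P(x_i) v_{i,j} = F(x_i) v_{i,j}`. -/
theorem lagrange_interpolation_kernel {p : ℕ} (a b : ℝ)
    (W : ℝ → Matrix (Fin p) (Fin p) ℝ) (hW : IsWeight p a b W)
    (P : ℕ → Polynomial (Matrix (Fin p) (Fin p) ℝ))
    (hP : IsOrthonormal p a b W P)
    (n : ℕ) (hn : 1 ≤ n) {k : ℕ}
    (x : Fin k → ℝ) (hx : Function.Injective x)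
    (m : Fin k → ℕ)
    (hmul : ∀ i, ((matPolyEquiv.symm (P n)).det).rootMultiplicity (x i) = m i)
    (hall : ∀ z : ℝ, ((matPolyEquiv.symm (P n)).det).eval z = 0 → ∃ i, z = x i)
    (hsum : (∑ i, m i) = n * p)
    (v : (i : Fin k) → Fin (m i) → Fin p → ℝ)
    (hv : ∀ i, LinearIndependent ℝ (v i))
    (hker : ∀ i j, mev (P n) (x i) *ᵥ v i j = 0)
    (e : (Fin n × Fin p) ≃ LagIdx k m)
    (hinv : IsUnit (colLag x m v e (n := n))) :
    (∀ i, IsUnit (Lmat P n x m v i)) ∧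
      (∀ i, ∃ Q : Polynomial (Matrix (Fin p) (Fin p) ℝ), Q.degree < (n : ℕ) ∧
          ∀ t : ℝ, mev Q t = Lam P n x m v i * Kker P n (x i) t) ∧
      (∀ i j, (Lam P n x m v i * Kker P n (x i) (x i)) *ᵥ v i j = v i j) ∧
      (∀ i l, l ≠ i → ∀ j,
        (Lam P n x m v i * Kker P n (x i) (x l)) *ᵥ v l j = 0) ∧
      ∀ (F : ℝ → Matrix (Fin p) (Fin p) ℝ) (i : Fin k) (j : Fin (m i)),
        (∑ i', F (x i') * (Lam P n x m v i' * Kker P n (x i') (x i)))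
          *ᵥ v i j = F (x i) *ᵥ v i j := by
  have hunit : ∀ i, IsUnit (Lmat P n x m v i) := fun i =>
    isUnit_Lmat P hP.2.2.1 hn x m v i (hv i)
  have hdiag : ∀ i j, (Lam P n x m v i * Kker P n (x i) (x i)) *ᵥ v i j = v i j := by
    intro i j
    have hdet := (Matrix.isUnit_iff_isUnit_det _).1 (hunit i)
    have hV : Lam P n x m v i * Kker P n (x i) (x i) * Vmat m v i = Vmat m v i := by
      rw [Lam, Matrix.mul_assoc, Matrix.mul_assoc, ← Lmat_eq, Matrix.mul_assoc,
        Matrix.nonsing_inv_mul _ hdet, Matrix.mul_one]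
    rw [← Vmat_mulVec_single m v i j, Matrix.mulVec_mulVec, hV]
  have hoff : ∀ i l, l ≠ i → ∀ j,
      (Lam P n x m v i * Kker P n (x i) (x l)) *ᵥ v l j = 0 := by
    intro i l hli j
    have hzero : (Vmat m v i)ᵀ *ᵥ (Kker P n (x i) (x l) *ᵥ v l j) = 0 := by
      ext s
      exact hP.dotProduct_Kker_eq_zero hW (fun h => hli (hx h).symm) (hker i s) (hker l j)
    rw [Lam, ← Matrix.mulVec_mulVec, ← Matrix.mulVec_mulVec, hzero, Matrix.mulVec_zero]
  refine ⟨hunit, fun i => ?_, hdiag, hoff, fun F i j => ?_⟩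
  · refine ⟨∑ l ∈ Finset.range n, C (Lam P n x m v i * (mev (P l) (x i))ᵀ) * P l, ?_, ?_⟩
    · rw [degree_lt_iff_coeff_zero]
      intro q hq
      rw [finsetSum_coeff]
      refine Finset.sum_eq_zero fun l hl => ?_
      rw [coeff_C_mul, coeff_eq_zero_of_natDegree_lt, mul_zero]
      rw [hP.1]
      exact (Finset.mem_range.1 hl).trans_le hq
    · intro t
      simp only [mev_sum_C_mul, Kker, Finset.mul_sum, Matrix.mul_assoc]
  · rw [Matrix.sum_mulVec, Finset.sum_eq_single i]
    · rw [← Matrix.mulVec_mulVec, hdiag]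
    · intro i' _ hi'
      rw [← Matrix.mulVec_mulVec, hoff i' i hi'.symm, Matrix.mulVec_zero]
    · exact fun h => absurd (Finset.mem_univ i) h
end

section
/- Let W be a weight matrix function on a finite interval [a,b] with a < b, and let n ≥ 1. Let x_1,...,x_k be distinct real numbers with positive integers m_1,...,m_k satisfying Σ_{i=1}^k m_i = np, for each i let v_{i,1},...,v_{i,m_i} ∈ ℝ^p be nonzero linearly independent vectors, and assume col(XJ^l)_{l=0}^{n-1} is invertible, where X is the p×np matrix with columns v_{i,j} and J is the np×np diagonal matrix with x_i repeated m_i times. For arbitrary m_i×m_i real matrices A_i set Λ_i = (v_{i,1} ... v_{i,m_i})·A_i·(v_{i,1}^T; ...; v_{i,m_i}^T). Then the quadrature formula Σ_{i=1}^k F(x_i)·Λ_i·G(x_i)^T cannot be exact for all p×p matrix polynomials F, G with deg F + deg G ≤ 2n; specifically, there exists a monic matrix polynomial Q of degree n (one with Q(x_i)·v_{i,j} = 0 for all i, j) such that ∫_a^b Q(x)·W(x)·Q(x)^T dx ≠ Σ_{i=1}^k Q(x_i)·Λ_i·Q(x_i)^T. -/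
open Polynomial Matrix MeasureTheory

/-- The matrix polynomial `X ^ n + ∑ l, B l X ^ l`. -/
noncomputable def monicMatrixPoly {p n : ℕ} (B : Fin n → Matrix (Fin p) (Fin p) ℝ) :
    Polynomial (Matrix (Fin p) (Fin p) ℝ) :=
  X ^ n + ∑ l : Fin n, C (B l) * X ^ (l : ℕ)

theorem monic_monicMatrixPoly {p n : ℕ} (B : Fin n → Matrix (Fin p) (Fin p) ℝ) :
    (monicMatrixPoly B).Monic :=
  monic_X_pow_add (degree_sum_fin_lt B)

theorem natDegree_monicMatrixPoly {p n : ℕ} (hp : 0 < p)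
    (B : Fin n → Matrix (Fin p) (Fin p) ℝ) : (monicMatrixPoly B).natDegree = n := by
  have : Nonempty (Fin p) := ⟨⟨0, hp⟩⟩
  refine natDegree_eq_of_degree_eq_some ?_
  rw [monicMatrixPoly, degree_add_eq_left_of_degree_lt, degree_X_pow]
  rw [degree_X_pow]
  exact degree_sum_fin_lt B

theorem mev_monicMatrixPoly {p n : ℕ} (B : Fin n → Matrix (Fin p) (Fin p) ℝ) (t : ℝ) :
    mev (monicMatrixPoly B) t = t ^ n • 1 + ∑ l : Fin n, t ^ (l : ℕ) • B l := by
  have hX (l : ℕ) : (X ^ l : (Matrix (Fin p) (Fin p) ℝ)[X]).eval (t • 1) = t ^ l • 1 := by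
    rw [eval_X_pow, _root_.smul_pow, one_pow]
  simp [mev, monicMatrixPoly, eval_finsetSum, hX, _root_.smul_pow]

theorem continuous_mev_monicMatrixPoly_apply {p n : ℕ} (B : Fin n → Matrix (Fin p) (Fin p) ℝ)
    (r s : Fin p) : Continuous fun t => mev (monicMatrixPoly B) t r s := by
  simp only [mev_monicMatrixPoly, Matrix.add_apply, Matrix.smul_apply, Matrix.sum_apply]
  fun_prop

/-- Diagonal entries of a monic matrix polynomial vanish almost nowhere. -/
theorem ae_mev_monicMatrixPoly_diag_ne_zero {p n : ℕ} (B : Fin n → Matrix (Fin p) (Fin p) ℝ)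
    (r : Fin p) : ∀ᵐ t : ℝ, mev (monicMatrixPoly B) t r r ≠ 0 := by
  set q : ℝ[X] := X ^ n + ∑ l : Fin n, C (B l r r) * X ^ (l : ℕ) with hq
  have hq0 : q ≠ 0 := (monic_X_pow_add (degree_sum_fin_lt fun l => B l r r)).ne_zero
  have heval : ∀ t, mev (monicMatrixPoly B) t r r = q.eval t := by
    intro t
    simp [mev_monicMatrixPoly, hq, eval_finsetSum, Matrix.sum_apply, mul_comm (t ^ _)]
  have hfin : {t : ℝ | q.eval t = 0}.Finite := by
    refine (q.roots.toFinset.finite_toSet).subset fun t ht => ?_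
    simpa [hq0] using ht
  rw [ae_iff]
  simpa [heval] using hfin.measure_zero volume

/-- A monic matrix polynomial of degree `n` annihilating all the pairs `(x_i, v_{i,j})`. -/
theorem exists_annihilating_monicMatrixPoly {p n k : ℕ} (x : Fin k → ℝ) (m : Fin k → ℕ)
    (v : (i : Fin k) → Fin (m i) → Fin p → ℝ) (e : (Fin n × Fin p) ≃ LagIdx k m)
    (hinv : IsUnit (colLag x m v e (n := n))) :
    ∃ B : Fin n → Matrix (Fin p) (Fin p) ℝ,
      ∀ i j, mev (monicMatrixPoly B) (x i) *ᵥ v i j = 0 := by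
  let R : Matrix (Fin p) (Fin n × Fin p) ℝ :=
    Matrix.of fun r c => -(x (e c).1 ^ n * v (e c).1 (e c).2 r)
  let M : Matrix (Fin p) (Fin n × Fin p) ℝ := R * (colLag x m v e (n := n))⁻¹
  have hM : M * colLag x m v e (n := n) = R :=
    Matrix.nonsing_inv_mul_cancel_right _ _ ((Matrix.isUnit_iff_isUnit_det _).mp hinv)
  refine ⟨fun l => Matrix.of fun r s => M r (l, s), fun i j => ?_⟩
  obtain ⟨c, hc⟩ := e.surjective ⟨i, j⟩
  have hcol (l : Fin n) (s : Fin p) :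
      colLag x m v e (l, s) c = v (e c).1 (e c).2 s * x (e c).1 ^ (l : ℕ) := by
    simp only [colLag, Jmat, Xmat, Matrix.diagonal_pow, Matrix.of_apply, Matrix.mul_diagonal,
      Pi.pow_apply]
  ext r
  have h : (M * colLag x m v e (n := n)) r c = -(x (e c).1 ^ n * v (e c).1 (e c).2 r) :=
    congrFun (congrFun hM r) c
  simp only [Matrix.mul_apply, Fintype.sum_prod_type, hcol] at h
  rw [hc] at h
  rw [mev_monicMatrixPoly, Matrix.add_mulVec, Matrix.smul_mulVec, Matrix.one_mulVec,
    Matrix.sum_mulVec]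
  simp only [Matrix.smul_mulVec, Pi.add_apply, Pi.smul_apply, smul_eq_mul, Finset.sum_apply,
    Matrix.mulVec, dotProduct, Matrix.of_apply, Pi.zero_apply, Finset.mul_sum]
  rw [← neg_eq_iff_add_eq_zero, ← h]
  exact Finset.sum_congr rfl fun l _ => Finset.sum_congr rfl fun s _ => by ring

theorem mInt_monicMatrixPoly_diag_pos {p n : ℕ} {a b : ℝ} (hab : a < b)
    {W : ℝ → Matrix (Fin p) (Fin p) ℝ} (hW : IsWeight p a b W)
    (B : Fin n → Matrix (Fin p) (Fin p) ℝ) (r : Fin p) :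
    0 < mInt a b (fun t => mev (monicMatrixPoly B) t * W t * (mev (monicMatrixPoly B) t)ᵀ)
      r r := by
  obtain ⟨-, -, hint, hpsd, hdet⟩ := hW
  set Q := monicMatrixPoly B
  have hpos : ∀ᵐ t ∂volume.restrict (Set.Ioc a b), 0 < (mev Q t * W t * (mev Q t)ᵀ) r r := by
    filter_upwards [ae_restrict_of_ae_restrict_of_subset Set.Ioc_subset_Icc_self hpsd,
      ae_restrict_of_ae_restrict_of_subset Set.Ioc_subset_Icc_self hdet,
      ae_restrict_of_ae (ae_mev_monicMatrixPoly_diag_ne_zero B r)] with t h1 h2 h3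
    have hpd : (W t).PosDef :=
      h1.posDef_iff_isUnit.mpr ((Matrix.isUnit_iff_isUnit_det _).mpr (isUnit_iff_ne_zero.mpr h2))
    have hne : mev Q t r ≠ 0 := fun h0 => h3 (congrFun h0 r)
    have hquad := hpd.dotProduct_mulVec_pos hne
    rw [star_trivial, Matrix.dotProduct_mulVec] at hquad
    exact hquad
  have hintegrable : IntervalIntegrable (fun t => (mev Q t * W t * (mev Q t)ᵀ) r r)
      volume a b := by
    simp only [Matrix.mul_apply, Matrix.transpose_apply]
    have hc := continuous_mev_monicMatrixPoly_apply B
    have hsum : ∀ s, IntervalIntegrable (fun t => ∑ l, mev Q t r l * W t l s) volume a b := by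
      intro s
      have := IntervalIntegrable.sum (μ := volume) (a := a) (b := b) Finset.univ
        (f := fun l t => mev Q t r l * W t l s)
        fun l _ => (hint l s).continuousOn_mul (hc r l).continuousOn
      simpa [Finset.sum_fn] using this
    have := IntervalIntegrable.sum (μ := volume) (a := a) (b := b) Finset.univ
      (f := fun s t => (∑ l, mev Q t r l * W t l s) * mev Q t r s)
      fun s _ => (hsum s).mul_continuousOn (hc r s).continuousOn
    simpa [Finset.sum_fn] using this
  simp only [mInt, Matrix.of_apply]
  rw [intervalIntegral.integral_pos_iff_support_of_nonneg_ae'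
    (by rw [Set.uIoc_of_le hab.le]; exact hpos.mono fun t ht => ht.le) hintegrable]
  refine ⟨hab, ?_⟩
  have hsupp : Function.support (fun t => (mev Q t * W t * (mev Q t)ᵀ) r r)
      =ᵐ[volume.restrict (Set.Ioc a b)] Set.univ :=
    Filter.eventuallyEq_univ.mpr (hpos.mono fun t ht => ht.ne')
  rw [← Measure.restrict_apply' measurableSet_Ioc, measure_congr hsupp,
    Measure.restrict_apply_univ, Real.volume_Ioc]
  simpa using hab

/-- No quadrature formula of the postulated form has degree of precision `2n`: for any
choice of the matrices `A_i`, with `Λ_i = (v_{i,1} ⋯ v_{i,m_i}) A_i (v_{i,1}ᵀ; ⋯)`,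
exactness fails for some pair of matrix polynomials of total degree `2n`; specifically
it fails for `F = G = Q̂`, a monic matrix polynomial of degree `n` annihilating all the
pairs `(x_i, v_{i,j})`. -/
theorem quadrature_not_exact_2n {p n : ℕ} (hp : 0 < p)
    (a b : ℝ) (hab : a < b)
    (W : ℝ → Matrix (Fin p) (Fin p) ℝ) (hW : IsWeight p a b W)
    {k : ℕ} (x : Fin k → ℝ) (hx : Function.Injective x)
    (m : Fin k → ℕ) (hm : ∀ i, 0 < m i) (hsum : (∑ i, m i) = n * p)
    (v : (i : Fin k) → Fin (m i) → Fin p → ℝ)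
    (hv0 : ∀ i j, v i j ≠ 0) (hv : ∀ i, LinearIndependent ℝ (v i))
    (e : (Fin n × Fin p) ≃ LagIdx k m)
    (hinv : IsUnit (colLag x m v e (n := n)))
    (A : (i : Fin k) → Matrix (Fin (m i)) (Fin (m i)) ℝ) :
    (¬ ∀ F G : Polynomial (Matrix (Fin p) (Fin p) ℝ),
        F.natDegree + G.natDegree ≤ 2 * n →
          mInt a b (fun t => mev F t * W t * (mev G t)ᵀ) =
            ∑ i, mev F (x i) * (Vmat m v i * A i * (Vmat m v i)ᵀ) *
              (mev G (x i))ᵀ) ∧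
      ∃ Q : Polynomial (Matrix (Fin p) (Fin p) ℝ),
        Q.natDegree = n ∧ Q.leadingCoeff = 1 ∧
        (∀ i j, mev Q (x i) *ᵥ v i j = 0) ∧
        mInt a b (fun t => mev Q t * W t * (mev Q t)ᵀ) ≠
          ∑ i, mev Q (x i) * (Vmat m v i * A i * (Vmat m v i)ᵀ) *
            (mev Q (x i))ᵀ := by
  have hspec : ∃ Q : Polynomial (Matrix (Fin p) (Fin p) ℝ),
      Q.natDegree = n ∧ Q.leadingCoeff = 1 ∧
      (∀ i j, mev Q (x i) *ᵥ v i j = 0) ∧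
      mInt a b (fun t => mev Q t * W t * (mev Q t)ᵀ) ≠
        ∑ i, mev Q (x i) * (Vmat m v i * A i * (Vmat m v i)ᵀ) * (mev Q (x i))ᵀ := by
    obtain ⟨B, hB⟩ := exists_annihilating_monicMatrixPoly x m v e hinv
    refine ⟨monicMatrixPoly B, natDegree_monicMatrixPoly hp B, monic_monicMatrixPoly B, hB,
      fun heq => ?_⟩
    have hV : ∀ i, mev (monicMatrixPoly B) (x i) * Vmat m v i = 0 := by
      intro i
      ext r j
      exact congrFun (hB i j) r
    have hpos := mInt_monicMatrixPoly_diag_pos hab hW B ⟨0, hp⟩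
    rw [heq] at hpos
    simp [← Matrix.mul_assoc, hV] at hpos
  refine ⟨fun hexact => ?_, hspec⟩
  obtain ⟨Q, hdeg, -, -, hne⟩ := hspec
  exact hne (hexact Q Q (by omega))
end

section
/- Let W be a weight matrix function on a finite interval [a,b], (P_n)_{n≥0} a sequence of orthonormal matrix polynomials with respect to W, and n ≥ 1. Let x_1,...,x_k be the distinct zeros of P_n with multiplicities m_1,...,m_k (as roots of det P_n) satisfying Σ_{i=1}^k m_i = np, for each i let v_{i,1},...,v_{i,m_i} ∈ ℝ^p be linearly independent vectors with P_n(x_i)·v_{i,j} = 0, and assume col(XJ^l)_{l=0}^{n-1} is invertible, where X is the p×np matrix with columns v_{i,j} and J is the np×np diagonal matrix with x_i repeated m_i times. For each i let L_i be the m_i×m_i matrix with entries (L_i)_{s,t} = v_{i,s}^T·(Σ_{l=0}^{n-1} P_l(x_i)^T·P_l(x_i))·v_{i,t} and set Λ_i = (v_{i,1} ... v_{i,m_i})·L_i^{-1}·(v_{i,1}^T; ...; v_{i,m_i}^T). Then each Λ_i is symmetric positive semidefinite, and for all p×p matrix polynomials F, G with deg F + deg G ≤ 2n − 1: ∫_a^b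 F(x)·W(x)·G(x)^T dx = Σ_{i=1}^k F(x_i)·Λ_i·G(x_i)^T. -/
open Polynomial Matrix MeasureTheory

/-- A matrix-valued form on matrix polynomials that is linear over constant matrices on the left,
linear up to transposition on the right, and for which multiplication by `X` is symmetric. -/
structure IsMatrixForm {p : ℕ}
    (B : (Matrix (Fin p) (Fin p) ℝ)[X] → (Matrix (Fin p) (Fin p) ℝ)[X] →
      Matrix (Fin p) (Fin p) ℝ) : Prop where
  add_left : ∀ F G H, B (F + G) H = B F H + B G H
  add_right : ∀ F G H, B F (G + H) = B F G + B F H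
  C_mul_left : ∀ A F G, B (C A * F) G = A * B F G
  C_mul_right : ∀ A F G, B F (C A * G) = B F G * Aᵀ
  X_mul : ∀ F G, B (X * F) G = B F (X * G)

section Expansion

variable {R : Type*} [Ring R]

/-- A sequence of polynomials of degrees `0, 1, 2, …` with invertible leading coefficients spans
all polynomials over the left constants. -/
theorem exists_eq_sum_C_mul_s17 (q : ℕ → R[X]) (hq : ∀ l, IsUnit ((q l).coeff l))
    (hq' : ∀ l j, l < j → (q l).coeff j = 0) (N : ℕ) :
    ∀ F : R[X], F.degree < N → ∃ A : ℕ → R, F = ∑ l ∈ Finset.range N, C (A l) * q l := by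
  induction N with
  | zero =>
    intro F hF
    exact ⟨0, by simpa using hF⟩
  | succ N ih =>
    intro F hF
    obtain ⟨u, hu⟩ := hq N
    have hdeg : (F - C (F.coeff N * ↑u⁻¹) * q N).degree < N := by
      rw [degree_lt_iff_coeff_zero] at hF ⊢
      intro j hj
      rcases hj.eq_or_lt with rfl | hj
      · simp [← hu, mul_assoc]
      · simp [hF j hj, hq' N j hj, -map_mul]
    obtain ⟨A, hA⟩ := ih _ hdeg
    refine ⟨Function.update A N (F.coeff N * ↑u⁻¹), ?_⟩
    rw [Finset.sum_range_succ, Function.update_self, ← sub_eq_iff_eq_add, hA]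
    refine Finset.sum_congr rfl fun l hl => ?_
    rw [Function.update_of_ne (Finset.mem_range.1 hl).ne]

end Expansion

namespace IsMatrixForm

variable {p : ℕ} {B B' : (Matrix (Fin p) (Fin p) ℝ)[X] → (Matrix (Fin p) (Fin p) ℝ)[X] →
  Matrix (Fin p) (Fin p) ℝ}

theorem sum_left (hB : IsMatrixForm B) {ι : Type*} (s : Finset ι) (f : ι → _) (G) :
    B (∑ l ∈ s, f l) G = ∑ l ∈ s, B (f l) G :=
  map_sum (AddMonoidHom.mk' (fun F => B F G) fun F H => hB.add_left F H G) f s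

theorem sum_right (hB : IsMatrixForm B) {ι : Type*} (s : Finset ι) (f : ι → _) (F) :
    B F (∑ l ∈ s, f l) = ∑ l ∈ s, B F (f l) :=
  map_sum (AddMonoidHom.mk' (fun G => B F G) fun G H => hB.add_right F G H) f s

theorem X_pow_mul (hB : IsMatrixForm B) (d : ℕ) :
    ∀ F G, B (X ^ d * F) G = B F (X ^ d * G) := by
  induction d with
  | zero => simp
  | succ d ih =>
    intro F G
    rw [pow_succ, mul_assoc, ih, hB.X_mul, ← mul_assoc, ← pow_succ', ← pow_succ]

theorem flip (hB : IsMatrixForm B) : IsMatrixForm fun F G => (B G F)ᵀ where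
  add_left F G H := by simp [hB.add_right]
  add_right F G H := by simp [hB.add_left]
  C_mul_left A F G := by simp [hB.C_mul_right]
  C_mul_right A F G := by simp [hB.C_mul_left]
  X_mul F G := by simp [hB.X_mul]

/-- Two forms that agree on a graded basis agree. -/
theorem eq_of_basis (hB : IsMatrixForm B) (hB' : IsMatrixForm B')
    (q : ℕ → (Matrix (Fin p) (Fin p) ℝ)[X]) (hq : ∀ l, IsUnit ((q l).coeff l))
    (hq' : ∀ l j, l < j → (q l).coeff j = 0) {N M : ℕ}
    (h : ∀ l < N, ∀ j < M, B (q l) (q j) = B' (q l) (q j))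
    {F G : (Matrix (Fin p) (Fin p) ℝ)[X]} (hF : F.degree < N) (hG : G.degree < M) :
    B F G = B' F G := by
  obtain ⟨A, rfl⟩ := exists_eq_sum_C_mul_s17 q hq hq' N F hF
  obtain ⟨A', rfl⟩ := exists_eq_sum_C_mul_s17 q hq hq' M G hG
  simp only [hB.sum_left, hB'.sum_left, hB.sum_right, hB'.sum_right, hB.C_mul_left,
    hB'.C_mul_left, hB.C_mul_right, hB'.C_mul_right]
  refine Finset.sum_congr rfl fun l hl => Finset.sum_congr rfl fun j hj => ?_
  rw [h l (Finset.mem_range.1 hl) j (Finset.mem_range.1 hj)]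

end IsMatrixForm

section Evaluation

variable {p : ℕ} (F G : (Matrix (Fin p) (Fin p) ℝ)[X]) (A : Matrix (Fin p) (Fin p) ℝ) (t : ℝ)

theorem mev_add : mev (F + G) t = mev F t + mev G t := eval_add

theorem mev_C_mul : mev (C A * F) t = A * mev F t := eval_C_mul

theorem mev_X_mul : mev (X * F) t = t • mev F t := by
  simp [mev, X_mul, eval_mul_X]

theorem mev_sum {ι : Type*} (s : Finset ι) (f : ι → (Matrix (Fin p) (Fin p) ℝ)[X]) :
    mev (∑ l ∈ s, f l) t = ∑ l ∈ s, mev (f l) t :=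
  eval_finsetSum s f _

theorem mev_X_pow (d : ℕ) : mev (X ^ d : (Matrix (Fin p) (Fin p) ℝ)[X]) t = t ^ d • 1 := by
  induction d with
  | zero => simp [mev]
  | succ d ih => rw [pow_succ', mev_X_mul, ih, smul_smul, pow_succ']

theorem continuous_mev_s17 : Continuous (mev F) := by
  unfold mev
  exact F.continuous.comp (by fun_prop)

end Evaluation

/-- The form `⟨F, G⟩ = ∫ F W Gᵀ`. -/
theorem isMatrixForm_mInt {p : ℕ} {a b : ℝ} {W : ℝ → Matrix (Fin p) (Fin p) ℝ}
    (hW : ∀ i j, IntervalIntegrable (fun x => W x i j) volume a b) :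
    IsMatrixForm fun F G => mInt a b fun t => mev F t * W t * (mev G t)ᵀ := by
  have hsum {f : Fin p → ℝ → ℝ} (hf : ∀ r, IntervalIntegrable (f r) volume a b) :
      IntervalIntegrable (fun t => ∑ r, f r t) volume a b := by
    simpa only [Finset.sum_fn] using IntervalIntegrable.sum Finset.univ fun r _ => hf r
  have hint : ∀ (F G : (Matrix (Fin p) (Fin p) ℝ)[X]) i j,
      IntervalIntegrable (fun t => (mev F t * W t * (mev G t)ᵀ) i j) volume a b := by
    intro F G i j
    simp only [mul_apply, transpose_apply, Finset.sum_mul]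
    refine hsum fun r => hsum fun s => ?_
    exact ((hW s r).continuousOn_mul ((continuous_mev_s17 F).matrix_elem i s).continuousOn
      ).mul_continuousOn ((continuous_mev_s17 G).matrix_elem j r).continuousOn
  constructor
  · intro F G H
    ext i j
    simp only [mInt, of_apply, Matrix.add_apply, mev_add, Matrix.add_mul]
    exact intervalIntegral.integral_add (hint F H i j) (hint G H i j)
  · intro F G H
    ext i j
    simp only [mInt, of_apply, Matrix.add_apply, mev_add, Matrix.mul_add, transpose_add]
    exact intervalIntegral.integral_add (hint F G i j) (hint F H i j)
  · intro A F G
    ext i j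
    simp only [mInt, mev_C_mul, Matrix.mul_assoc]
    simp only [of_apply, Matrix.mul_apply (M := A), ← Matrix.mul_assoc]
    rw [intervalIntegral.integral_finsetSum fun r _ => (hint F G r j).const_mul _]
    simp
  · intro A F G
    ext i j
    simp only [mInt, mev_C_mul, transpose_mul, ← Matrix.mul_assoc]
    simp only [of_apply, Matrix.mul_apply (N := Aᵀ)]
    rw [intervalIntegral.integral_finsetSum fun r _ => (hint F G i r).mul_const _]
    simp
  · intro F G
    simp [mev_X_mul]

/-- The discrete form `∑ F(xᵢ) Λᵢ G(xᵢ)ᵀ`. -/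
theorem isMatrixForm_sum {p k : ℕ} (x : Fin k → ℝ) (Λ : Fin k → Matrix (Fin p) (Fin p) ℝ) :
    IsMatrixForm fun F G => ∑ i, mev F (x i) * Λ i * (mev G (x i))ᵀ where
  add_left F G H := by simp [mev_add, Matrix.add_mul, Finset.sum_add_distrib]
  add_right F G H := by simp [mev_add, Matrix.mul_add, Finset.sum_add_distrib]
  C_mul_left A F G := by simp [mev_C_mul, Matrix.mul_assoc, Finset.mul_sum]
  C_mul_right A F G := by simp [mev_C_mul, Matrix.mul_assoc, Finset.sum_mul]
  X_mul F G := by simp [mev_X_mul]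

namespace IsMatrixForm

variable {p : ℕ} {B : (Matrix (Fin p) (Fin p) ℝ)[X] → (Matrix (Fin p) (Fin p) ℝ)[X] →
  Matrix (Fin p) (Fin p) ℝ} {P : ℕ → (Matrix (Fin p) (Fin p) ℝ)[X]}

/-- A form admitting a graded orthonormal basis is symmetric. -/
theorem transpose_eq (hB : IsMatrixForm B) (hP : ∀ l, IsUnit ((P l).coeff l))
    (hP' : ∀ l j, l < j → (P l).coeff j = 0) (hort : ∀ l j, B (P l) (P j) = if l = j then 1 else 0)
    (F G : (Matrix (Fin p) (Fin p) ℝ)[X]) : (B G F)ᵀ = B F G := by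
  refine hB.flip.eq_of_basis hB P hP hP' (N := F.natDegree + 1) (M := G.natDegree + 1) ?_
    (degree_lt_iff_coeff_zero _ _ |>.2 fun j hj => coeff_eq_zero_of_natDegree_lt hj)
    (degree_lt_iff_coeff_zero _ _ |>.2 fun j hj => coeff_eq_zero_of_natDegree_lt hj)
  intro l _ j _
  simp only [hort, eq_comm (a := j)]
  split_ifs <;> simp

theorem ortho_of_degree_lt (hB : IsMatrixForm B) (hP : ∀ l, IsUnit ((P l).coeff l))
    (hP' : ∀ l j, l < j → (P l).coeff j = 0) (hort : ∀ l j, B (P l) (P j) = if l = j then 1 else 0)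
    {n : ℕ} {G : (Matrix (Fin p) (Fin p) ℝ)[X]} (hG : G.degree < n) : B (P n) G = 0 := by
  obtain ⟨A, rfl⟩ := exists_eq_sum_C_mul_s17 P hP hP' n G hG
  rw [hB.sum_right]
  refine Finset.sum_eq_zero fun l hl => ?_
  rw [hB.C_mul_right, hort, if_neg (Finset.mem_range.1 hl).ne', Matrix.zero_mul]

/-- The reproducing property of the kernel, on polynomials of degree at most `n`, along a
rootvector of `P n`. -/
theorem reproducing (hB : IsMatrixForm B) (hP : ∀ l, IsUnit ((P l).coeff l))
    (hP' : ∀ l j, l < j → (P l).coeff j = 0) (hort : ∀ l j, B (P l) (P j) = if l = j then 1 else 0)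
    {n : ℕ} {F : (Matrix (Fin p) (Fin p) ℝ)[X]} (hF : F.degree < ((n + 1 : ℕ) : WithBot ℕ))
    {y : ℝ} {u : Fin p → ℝ} (hu : mev (P n) y *ᵥ u = 0) :
    B F (∑ l ∈ Finset.range n, C (mev (P l) y)ᵀ * P l) *ᵥ u = mev F y *ᵥ u := by
  obtain ⟨A, rfl⟩ := exists_eq_sum_C_mul_s17 P hP hP' (n + 1) F hF
  simp only [hB.sum_left, hB.sum_right, hB.C_mul_left, hB.C_mul_right, hort, mev_sum, mev_C_mul,
    transpose_transpose]
  rw [Finset.sum_range_succ, Finset.sum_range_succ, Matrix.add_mulVec, Matrix.add_mulVec,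
    ← mulVec_mulVec _ (A n), hu, mulVec_zero]
  congr 1
  · congr 1
    refine Finset.sum_congr rfl fun l hl => ?_
    simp [Finset.mem_range.1 hl]
  · rw [Finset.sum_eq_zero, zero_mulVec]
    intro l hl
    have hne : n ≠ l := (Finset.mem_range.1 hl).ne'
    simp [hne]

/-- The kernel vanishes between rootvectors of `P n` belonging to distinct zeros. -/
theorem kernel_eq_zero (hB : IsMatrixForm B) (hP : ∀ l, IsUnit ((P l).coeff l))
    (hP' : ∀ l j, l < j → (P l).coeff j = 0) (hort : ∀ l j, B (P l) (P j) = if l = j then 1 else 0)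
    {n : ℕ} {y z : ℝ} (hyz : y ≠ z) {u w : Fin p → ℝ}
    (hu : mev (P n) y *ᵥ u = 0) (hw : mev (P n) z *ᵥ w = 0) :
    u ⬝ᵥ (Kker P n y z *ᵥ w) = 0 := by
  set K : ℝ → (Matrix (Fin p) (Fin p) ℝ)[X] :=
    fun s => ∑ l ∈ Finset.range n, C (mev (P l) s)ᵀ * P l with hK
  have hKdeg : ∀ s, (X * K s).degree < ((n + 1 : ℕ) : WithBot ℕ) := by
    intro s
    rw [degree_lt_iff_coeff_zero]
    intro j hj
    obtain ⟨j, rfl⟩ := Nat.exists_eq_add_of_lt (Nat.lt_of_lt_of_le n.succ_pos hj)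
    simp only [zero_add, coeff_X_mul, hK, finsetSum_coeff, coeff_C_mul]
    refine Finset.sum_eq_zero fun l hl => ?_
    rw [hP' l j (by have := Finset.mem_range.1 hl; omega), mul_zero]
  have hKev : ∀ s t, mev (K s) t = Kker P n s t := by
    intro s t
    simp [hK, Kker, mev_sum, mev_C_mul]
  have hKt : (Kker P n z y)ᵀ = Kker P n y z := by
    simp [Kker, transpose_sum, transpose_mul]
  have h1 := hB.reproducing hP hP' hort (hKdeg y) hw
  have h2 := hB.reproducing hP hP' hort (hKdeg z) hu
  change B (X * K y) (K z) *ᵥ w = _ at h1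
  change B (X * K z) (K y) *ᵥ u = _ at h2
  rw [mev_X_mul, hKev, smul_mulVec] at h1 h2
  have h3 : u ⬝ᵥ (B (X * K y) (K z) *ᵥ w) = w ⬝ᵥ (B (X * K z) (K y) *ᵥ u) := by
    rw [hB.X_mul, ← hB.transpose_eq hP hP' hort, mulVec_transpose, dotProduct_comm,
      dotProduct_mulVec]
  have h4 : w ⬝ᵥ (Kker P n z y *ᵥ u) = u ⬝ᵥ (Kker P n y z *ᵥ w) := by
    rw [← hKt, mulVec_transpose, dotProduct_comm u, dotProduct_mulVec]
  rw [h1, h2, dotProduct_smul, dotProduct_smul, h4, smul_eq_mul, smul_eq_mul] at h3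
  have : (z - y) * (u ⬝ᵥ (Kker P n y z *ᵥ w)) = 0 := by linarith
  exact (mul_eq_zero.1 this).resolve_left (sub_ne_zero.2 hyz.symm)

end IsMatrixForm

/-- The matrix with columns `(P_l(xᵢ) v_{i,j})_{l < n}`. -/
noncomputable def nodeMatrix {p k : ℕ} (P : ℕ → (Matrix (Fin p) (Fin p) ℝ)[X]) (n : ℕ)
    (x : Fin k → ℝ) (m : Fin k → ℕ) (v : (i : Fin k) → Fin (m i) → Fin p → ℝ) :
    Matrix (Fin n × Fin p) (LagIdx k m) ℝ :=
  Matrix.of fun lr c => (mev (P lr.1) (x c.1) *ᵥ v c.1 c.2) lr.2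

section NodeMatrix

variable {p k n : ℕ} {P : ℕ → (Matrix (Fin p) (Fin p) ℝ)[X]} {x : Fin k → ℝ} {m : Fin k → ℕ}
  {v : (i : Fin k) → Fin (m i) → Fin p → ℝ}

theorem transpose_nodeMatrix_mul_self_apply (c d : LagIdx k m) :
    ((nodeMatrix P n x m v)ᵀ * nodeMatrix P n x m v) c d =
      v c.1 c.2 ⬝ᵥ (Kker P n (x c.1) (x d.1) *ᵥ v d.1 d.2) := by
  simp only [Kker, Matrix.sum_mulVec, dotProduct_sum, mul_apply, transpose_apply,
    Fintype.sum_prod_type]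
  rw [← Fin.sum_univ_eq_sum_range
    fun l => v c.1 c.2 ⬝ᵥ (((mev (P l) (x c.1))ᵀ * mev (P l) (x d.1)) *ᵥ v d.1 d.2)]
  refine Finset.sum_congr rfl fun l _ => ?_
  rw [← mulVec_mulVec, dotProduct_mulVec, vecMul_transpose]
  rfl

theorem nodeMatrix_mulVec_apply (c : LagIdx k m → ℝ) (l : Fin n) :
    (fun r => (nodeMatrix P n x m v *ᵥ c) (l, r)) =
      ∑ d, c d • (mev (P l) (x d.1) *ᵥ v d.1 d.2) := by
  ext r
  simp [nodeMatrix, mulVec, dotProduct, Finset.sum_apply, mul_comm]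

theorem nodeMatrix_mulVec_injective (hP : ∀ l, IsUnit ((P l).coeff l))
    (hP' : ∀ l j, l < j → (P l).coeff j = 0) (e : (Fin n × Fin p) ≃ LagIdx k m)
    (hinv : IsUnit (colLag x m v e (n := n))) :
    Function.Injective (nodeMatrix P n x m v).mulVec := by
  rw [← Matrix.coe_mulVecLin, injective_iff_map_eq_zero]
  intro c hc
  rw [Matrix.mulVecLin_apply] at hc
  have hsum : ∀ l < n, ∑ d, c d • (mev (P l) (x d.1) *ᵥ v d.1 d.2) = 0 := by
    intro l hl
    rw [← nodeMatrix_mulVec_apply c ⟨l, hl⟩, hc]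
    rfl
  have hpow : ∀ l < n, ∑ d, (c d * x d.1 ^ l) • v d.1 d.2 = 0 := by
    intro l hl
    obtain ⟨A, hA⟩ := exists_eq_sum_C_mul_s17 P hP hP' n (X ^ l)
      ((degree_X_pow_le l).trans_lt (by exact_mod_cast hl))
    have h : ∀ d : LagIdx k m, (c d * x d.1 ^ l) • v d.1 d.2 =
        ∑ j ∈ Finset.range n, A j *ᵥ (c d • (mev (P j) (x d.1) *ᵥ v d.1 d.2)) := by
      intro d
      have h0 := congrArg (fun M => M *ᵥ v d.1 d.2) (mev_X_pow (p := p) (x d.1) l)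
      simp only [smul_mulVec, one_mulVec] at h0
      rw [mul_smul, ← h0, hA, mev_sum, Matrix.sum_mulVec, Finset.smul_sum]
      simp [mev_C_mul, mulVec_smul]
    simp_rw [h]
    rw [Finset.sum_comm]
    refine Finset.sum_eq_zero fun j hj => ?_
    rw [← mulVec_sum, hsum j (Finset.mem_range.1 hj), mulVec_zero]
  have hcol : colLag x m v e (n := n) *ᵥ (c ∘ e) = 0 := by
    ext ⟨l, r⟩
    have := congrFun (hpow l l.2) r
    rw [← e.sum_comp, Finset.sum_apply] at this
    simpa [colLag, Xmat, Jmat, mulVec, dotProduct, diagonal_pow, mul_comm, mul_left_comm] using this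
  have hce : c ∘ e = 0 :=
    Matrix.mulVec_injective_of_isUnit hinv (hcol.trans (mulVec_zero _).symm)
  ext d
  simpa using congrFun hce (e.symm d)

theorem Lmat_eq_submatrix (i : Fin k) :
    Lmat P n x m v i = ((nodeMatrix P n x m v)ᵀ * nodeMatrix P n x m v).submatrix
      (fun j => ⟨i, j⟩) (fun j => ⟨i, j⟩) := by
  ext s t
  rw [submatrix_apply, transpose_nodeMatrix_mul_self_apply]
  rfl

theorem posDef_Lmat (hT : Function.Injective (nodeMatrix P n x m v).mulVec) (i : Fin k) :
    (Lmat P n x m v i).PosDef := by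
  rw [Lmat_eq_submatrix]
  have h := Matrix.PosDef.conjTranspose_mul_self _ hT
  rw [conjTranspose_eq_transpose_of_trivial] at h
  exact h.submatrix fun s t hst => by simpa using hst

theorem posSemidef_Lam (hT : Function.Injective (nodeMatrix P n x m v).mulVec) (i : Fin k) :
    (Lam P n x m v i).PosSemidef := by
  have h := (posDef_Lmat hT i).inv.posSemidef.mul_mul_conjTranspose_same (Vmat m v i)
  rwa [conjTranspose_eq_transpose_of_trivial] at h

theorem mul_Vmat_apply (l : Fin n) (i : Fin k) (r : Fin p) (j : Fin (m i)) :
    (mev (P l) (x i) * Vmat m v i) r j = nodeMatrix P n x m v (l, r) ⟨i, j⟩ := rfl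

/-- The quadrature sum evaluated on `P_l`, `P_j` with `l, j < n`. -/
theorem sum_Lam_orthonormal (hT : Function.Injective (nodeMatrix P n x m v).mulVec)
    (e : (Fin n × Fin p) ≃ LagIdx k m)
    (hK : ∀ i j, i ≠ j → ∀ s t, v i s ⬝ᵥ (Kker P n (x i) (x j) *ᵥ v j t) = 0) (l j : Fin n) :
    ∑ i, mev (P l) (x i) * Lam P n x m v i * (mev (P j) (x i))ᵀ = if l = j then 1 else 0 := by
  set T := nodeMatrix P n x m v with hTdef
  set E := blockDiagonal' fun i => (Lmat P n x m v i)⁻¹ with hE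
  have hD : Tᵀ * T = blockDiagonal' fun i => Lmat P n x m v i := by
    ext ⟨i, s⟩ ⟨i', t⟩
    rw [transpose_nodeMatrix_mul_self_apply]
    by_cases h : i = i'
    · subst h
      rw [blockDiagonal'_apply_eq]
      rfl
    · rw [blockDiagonal'_apply_ne _ _ _ h, hK _ _ h]
  have hED : E * Tᵀ * T = 1 := by
    rw [Matrix.mul_assoc, hD, hE, ← blockDiagonal'_mul, ← blockDiagonal'_one]
    congr 1
    ext1 i
    exact nonsing_inv_mul _ ((Matrix.isUnit_iff_isUnit_det _).1 (posDef_Lmat hT i).isUnit)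
  have hTE : T * (E * Tᵀ) = 1 := (Matrix.mul_eq_one_comm_of_equiv e.symm).1 hED
  ext r s
  have h := congrFun (congrFun hTE (l, r)) (j, s)
  have hlhs : (T * (E * Tᵀ)) (l, r) (j, s) =
      (∑ i, mev (P l) (x i) * Lam P n x m v i * (mev (P j) (x i))ᵀ) r s := by
    rw [Matrix.sum_apply, mul_apply, Fintype.sum_sigma]
    refine Finset.sum_congr rfl fun i _ => ?_
    have hre : mev (P l) (x i) * Lam P n x m v i * (mev (P j) (x i))ᵀ =
        (mev (P l) (x i) * Vmat m v i) *
          ((Lmat P n x m v i)⁻¹ * (mev (P j) (x i) * Vmat m v i)ᵀ) := by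
      simp only [Lam, transpose_mul, Matrix.mul_assoc]
    rw [hre, mul_apply]
    refine Finset.sum_congr rfl fun c _ => ?_
    rw [mul_Vmat_apply, mul_apply, mul_apply, Fintype.sum_sigma, Finset.sum_eq_single i]
    · simp only [hE, blockDiagonal'_apply_eq, transpose_apply, mul_Vmat_apply, hTdef]
    · intro i' _ hi
      exact Finset.sum_eq_zero fun d _ => by
        rw [hE, blockDiagonal'_apply_ne _ _ _ hi.symm, zero_mul]
    · simp
  rw [← hlhs, h, one_apply]
  by_cases hlj : l = j <;> simp [hlj, one_apply]

theorem mul_Lam_eq_zero {M : Matrix (Fin p) (Fin p) ℝ} {i : Fin k} (h : ∀ j, M *ᵥ v i j = 0) :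
    M * Lam P n x m v i = 0 := by
  have hV : M * Vmat m v i = 0 := by
    ext r j
    exact congrFun (h j) r
  rw [Lam, Matrix.mul_assoc, ← Matrix.mul_assoc, hV, Matrix.zero_mul]

theorem Lam_mul_transpose_eq_zero {M : Matrix (Fin p) (Fin p) ℝ} {i : Fin k}
    (h : ∀ j, M *ᵥ v i j = 0) : Lam P n x m v i * Mᵀ = 0 := by
  have hV : M * Vmat m v i = 0 := by
    ext r j
    exact congrFun (h j) r
  rw [Lam, Matrix.mul_assoc, ← transpose_mul, hV, transpose_zero, Matrix.mul_zero]

end NodeMatrix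

/-- The Gaussian quadrature formula built from the zeros `x_i`, rootvectors `v_{i,j}`
of the orthonormal matrix polynomial `Pₙ` and the coefficients
`Λ_i = (v_{i,1} ⋯ v_{i,m_i}) L_i⁻¹ (v_{i,1}ᵀ; ⋯; v_{i,m_i}ᵀ)`: each `Λ_i` is
symmetric positive semidefinite and the formula is exact for all matrix polynomials
`F, G` with `deg F + deg G ≤ 2n − 1`. -/
theorem gaussian_quadrature {p : ℕ} (a b : ℝ)
    (W : ℝ → Matrix (Fin p) (Fin p) ℝ) (hW : IsWeight p a b W)
    (P : ℕ → Polynomial (Matrix (Fin p) (Fin p) ℝ))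
    (hP : IsOrthonormal p a b W P)
    (n : ℕ) (hn : 1 ≤ n) {k : ℕ}
    (x : Fin k → ℝ) (hx : Function.Injective x)
    (m : Fin k → ℕ)
    (hmul : ∀ i, ((matPolyEquiv.symm (P n)).det).rootMultiplicity (x i) = m i)
    (hall : ∀ z : ℝ, ((matPolyEquiv.symm (P n)).det).eval z = 0 → ∃ i, z = x i)
    (hsum : (∑ i, m i) = n * p)
    (v : (i : Fin k) → Fin (m i) → Fin p → ℝ)
    (hv : ∀ i, LinearIndependent ℝ (v i))
    (hker : ∀ i j, mev (P n) (x i) *ᵥ v i j = 0)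
    (e : (Fin n × Fin p) ≃ LagIdx k m)
    (hinv : IsUnit (colLag x m v e (n := n))) :
    (∀ i, (Lam P n x m v i).PosSemidef) ∧
      ∀ F G : Polynomial (Matrix (Fin p) (Fin p) ℝ),
        F.natDegree + G.natDegree ≤ 2 * n - 1 →
          mInt a b (fun t => mev F t * W t * (mev G t)ᵀ) =
            ∑ i, mev F (x i) * Lam P n x m v i * (mev G (x i))ᵀ := by
  have hu : ∀ l, IsUnit ((P l).coeff l) := fun l => by
    have := hP.2.1 l
    rwa [leadingCoeff, hP.1] at this
  have hc : ∀ l j, l < j → (P l).coeff j = 0 := fun l j hlj =>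
    coeff_eq_zero_of_natDegree_lt ((hP.1 l).trans_lt hlj)
  have hT := nodeMatrix_mulVec_injective hu hc e hinv
  refine ⟨posSemidef_Lam hT, fun F G hFG => ?_⟩
  have hB := isMatrixForm_mInt hW.2.2.1
  have hQ := isMatrixForm_sum x (Lam P n x m v)
  have hort := hP.2.2.2
  have hK : ∀ i j, i ≠ j → ∀ s t, v i s ⬝ᵥ (Kker P n (x i) (x j) *ᵥ v j t) = 0 :=
    fun i j hij s t => hB.kernel_eq_zero hu hc hort (hx.ne hij) (hker i s) (hker j t)
  set q : ℕ → (Matrix (Fin p) (Fin p) ℝ)[X] :=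
    fun l => if l < n then P l else X ^ (l - n) * P n with hq
  have hqc : ∀ l j, l < j → (q l).coeff j = 0 := by
    intro l j hlj
    by_cases hl : l < n
    · simp [hq, hl, hc l j hlj]
    · simp only [hq, hl, if_false, coeff_X_pow_mul']
      rw [if_pos (by omega), hc _ _ (by omega)]
  have hqu : ∀ l, IsUnit ((q l).coeff l) := by
    intro l
    by_cases hl : l < n
    · simpa [hq, hl] using hu l
    · simp only [hq, hl, if_false, coeff_X_pow_mul']
      rw [if_pos (by omega), show l - (l - n) = n by omega]
      exact hu n
  have hdeg : ∀ H : (Matrix (Fin p) (Fin p) ℝ)[X], H.degree < (H.natDegree + 1 : ℕ) := fun H =>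
    (degree_lt_iff_coeff_zero _ _).2 fun j hj => coeff_eq_zero_of_natDegree_lt hj
  have hshift : ∀ l j, j < n → n ≤ l → l + j ≤ 2 * n - 1 →
      (X ^ (l - n) * P j).degree < (n : WithBot ℕ) := by
    intro l j hj hl hlj
    rw [degree_lt_iff_coeff_zero]
    intro d hd
    rw [coeff_X_pow_mul', if_pos (by omega), hc _ _ (by omega)]
  refine hB.eq_of_basis hQ q hqu hqc ?_ (hdeg F) (hdeg G)
  intro l hl j hj
  rcases lt_or_ge l n with hln | hln <;> rcases lt_or_ge j n with hjn | hjn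
  · simp only [hq, hln, hjn, if_true]
    rw [hort, sum_Lam_orthonormal hT e hK ⟨l, hln⟩ ⟨j, hjn⟩]
    simp
  · simp only [hq, hln, hjn.not_gt, if_true, if_false]
    rw [← hB.X_pow_mul, ← hQ.X_pow_mul, ← hB.transpose_eq hu hc hort,
      hB.ortho_of_degree_lt hu hc hort (hshift j l hln hjn (by omega)), transpose_zero]
    refine (Finset.sum_eq_zero fun i _ => ?_).symm
    rw [Matrix.mul_assoc, Lam_mul_transpose_eq_zero (hker i), Matrix.mul_zero]
  · simp only [hq, hln.not_gt, hjn, if_true, if_false]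
    rw [hB.X_pow_mul, hQ.X_pow_mul,
      hB.ortho_of_degree_lt hu hc hort (hshift l j hjn hln (by omega))]
    refine (Finset.sum_eq_zero fun i _ => ?_).symm
    rw [mul_Lam_eq_zero (hker i), Matrix.zero_mul]
  · omega
end
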